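/- arXiv:2605.25992 — 10 statements merged into one kernel-verified Lean document; each statement's English description precedes it below -/
import Mathlib

section
/- Let K be a normed field (a field with a multiplicative norm, i.e., an absolute value) in which 27 ≠ 0 (equivalently, the characteristic of K is not 3). Let p, q ∈ K with p ≠ 0, and set Δ := −4p³ − 27q². If the discriminant series ∑_{n≥0} binom(3n,n)·(−Δ/(27p³))ⁿ converges unconditionally to β ∈ K (i.e., the term function n ↦ binom(3n,n)·(−Δ/(27p³))ⁿ has sum β in the sense of Mathlib's HasSum), then α := (3q/p)·β satisfies α³ + p·α + q = 0. -/
/-- The generating function of the binomial coefficients `(3n).choose n`. -/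
noncomputable def tripleBinomialSeries : PowerSeries ℤ :=
  PowerSeries.mk fun n => ((3 * n).choose n : ℤ)

/-- An `m`-th finite difference of `n ↦ (3n).choose m`. -/
theorem sum_neg_one_pow_mul_choose_mul_choose_three_mul (m : ℕ) :
    ∑ n ∈ Finset.range (m + 1), (-1 : ℤ) ^ (m - n) * m.choose n * (3 * n).choose m = 3 ^ m := by
  have key : ((1 + Polynomial.X : Polynomial ℤ) ^ 3 - 1) ^ m =
      ∑ n ∈ Finset.range (m + 1),
        (1 + Polynomial.X) ^ (3 * n) * Polynomial.C ((-1 : ℤ) ^ (m - n) * m.choose n) := by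
    rw [sub_eq_add_neg, add_pow]
    refine Finset.sum_congr rfl fun n _ => ?_
    simp only [map_mul, map_pow, map_neg, map_one, map_natCast, pow_mul]
    ring
  have hfac : ((1 + Polynomial.X : Polynomial ℤ) ^ 3 - 1) ^ m =
      (3 + 3 * Polynomial.X + Polynomial.X ^ 2) ^ m * Polynomial.X ^ m := by
    rw [← mul_pow]
    congr 1
    ring
  have h := congrArg (fun P => Polynomial.coeff P m) (hfac.symm.trans key)
  have h0 : Polynomial.coeff ((3 + 3 * Polynomial.X + Polynomial.X ^ 2 : Polynomial ℤ) ^ m *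
      Polynomial.X ^ m) m = 3 ^ m := by
    rw [Polynomial.coeff_mul_X_pow', if_pos le_rfl, Nat.sub_self,
      Polynomial.coeff_zero_eq_eval_zero]
    simp
  simp only [h0, Polynomial.finsetSum_coeff, Polynomial.coeff_mul_C,
    Polynomial.coeff_one_add_X_pow] at h
  rw [h]
  exact Finset.sum_congr rfl fun n _ => by ring

theorem coeff_one_sub_X_pow (N k : ℕ) :
    PowerSeries.coeff k ((1 - PowerSeries.X : PowerSeries ℤ) ^ N) = (-1) ^ k * N.choose k := by
  have h : (1 - PowerSeries.X : PowerSeries ℤ) ^ N =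
      PowerSeries.rescale (-1) (((1 + Polynomial.X) ^ N : Polynomial ℤ) : PowerSeries ℤ) := by
    simp [PowerSeries.rescale_X, sub_eq_add_neg]
  rw [h, PowerSeries.coeff_rescale, Polynomial.coeff_coe, Polynomial.coeff_one_add_X_pow]

/-- The substitution `w ↦ w (1 - w) ^ 2`, which rationalises the cubic equation. -/
noncomputable def cubicParametrization : PowerSeries ℤ :=
  PowerSeries.X * (1 - PowerSeries.X) ^ 2

theorem coeff_cubicParametrization_pow (n m : ℕ) :
    PowerSeries.coeff m (cubicParametrization ^ n) =
      if n ≤ m then (-1) ^ (m - n) * ((2 * n).choose (m - n) : ℤ) else 0 := by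
  rw [cubicParametrization, mul_pow, ← pow_mul, PowerSeries.coeff_X_pow_mul', coeff_one_sub_X_pow]

theorem constantCoeff_cubicParametrization :
    PowerSeries.constantCoeff cubicParametrization = 0 := by
  simp [cubicParametrization]

theorem hasSubst_cubicParametrization : PowerSeries.HasSubst cubicParametrization :=
  PowerSeries.HasSubst.of_constantCoeff_zero' constantCoeff_cubicParametrization

theorem subst_cubicParametrization_injective :
    Function.Injective fun f : PowerSeries ℤ => f.subst cubicParametrization := by
  have hu : IsUnit (PowerSeries.coeff 1 cubicParametrization) := by
    have h := coeff_cubicParametrization_pow 1 1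
    rw [pow_one] at h
    simp [h]
  refine Function.LeftInverse.injective
    (g := PowerSeries.subst (cubicParametrization.substInvOfIsUnit hu)) fun f => ?_
  rw [PowerSeries.subst_comp_subst_apply hasSubst_cubicParametrization
      (PowerSeries.HasSubst.substInvOfIsUnit _ hu),
    PowerSeries.subst_substInvOfIsUnit_right _ constantCoeff_cubicParametrization hu,
    PowerSeries.X_subst]

theorem subst_tripleBinomialSeries :
    tripleBinomialSeries.subst cubicParametrization = PowerSeries.mk fun m => (3 : ℤ) ^ m := by
  ext m
  rw [PowerSeries.coeff_subst' hasSubst_cubicParametrization, PowerSeries.coeff_mk,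
    ← sum_neg_one_pow_mul_choose_mul_choose_three_mul,
    finsum_eq_sum_of_support_subset (s := Finset.range (m + 1))]
  · refine Finset.sum_congr rfl fun n hn => ?_
    have hnm : n ≤ m := Nat.lt_succ_iff.mp (Finset.mem_range.mp hn)
    rw [coeff_cubicParametrization_pow, if_pos hnm, tripleBinomialSeries, PowerSeries.coeff_mk,
      smul_eq_mul]
    have h : (3 * n).choose m * m.choose n = (3 * n).choose n * (2 * n).choose (m - n) := by
      rw [Nat.choose_mul hnm, show 3 * n - n = 2 * n by omega]
    have h' : ((3 * n).choose m * m.choose n : ℤ) = (3 * n).choose n * (2 * n).choose (m - n) := by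
      exact_mod_cast h
    linear_combination -(-1 : ℤ) ^ (m - n) * h'
  · intro n hn
    by_contra hnm
    refine hn ?_
    have : ¬ n ≤ m := by simpa [Nat.lt_succ_iff] using hnm
    simp [coeff_cubicParametrization_pow, this]

/-- The generating function `S` of `(3n).choose n` satisfies `(27X - 4) S³ + 3S + 1 = 0`. -/
theorem tripleBinomialSeries_cubic :
    (27 * PowerSeries.X - 4) * tripleBinomialSeries ^ 3 + 3 * tripleBinomialSeries + 1 = 0 := by
  set G : PowerSeries ℤ := PowerSeries.mk fun m => (3 : ℤ) ^ m with hG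
  have hgeom : (1 - 3 * PowerSeries.X) * G = 1 := by
    have h := PowerSeries.mk_one_mul_one_sub_eq_one ℤ
    have h' := congrArg (PowerSeries.rescale (3 : ℤ)) h
    rw [map_mul, PowerSeries.rescale_mk] at h'
    simp [PowerSeries.rescale_X] at h'
    rw [mul_comm]
    exact h'
  apply subst_cubicParametrization_injective
  simp only [← PowerSeries.coe_substAlgHom hasSubst_cubicParametrization]
  simp only [map_add, map_sub, map_mul, map_pow, map_ofNat, map_one, map_zero,
    PowerSeries.substAlgHom_X]
  rw [PowerSeries.coe_substAlgHom, subst_tripleBinomialSeries, ← hG, cubicParametrization]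
  set x : PowerSeries ℤ := PowerSeries.X
  have h3 : (1 - 3 * x) ^ 3 * ((27 * (x * (1 - x) ^ 2) - 4) * G ^ 3 + 3 * G + 1) = 0 := by
    linear_combination (27 * (x * (1 - x) ^ 2) - 4) *
      (((1 - 3 * x) * G) ^ 2 + (1 - 3 * x) * G + 1) * hgeom + 3 * (1 - 3 * x) ^ 2 * hgeom
  calc _ = ((1 - 3 * x) * G) ^ 3 * ((27 * (x * (1 - x) ^ 2) - 4) * G ^ 3 + 3 * G + 1) := by
        rw [hgeom]; ring
    _ = 0 := by rw [mul_pow, mul_right_comm, h3, zero_mul]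

section Evaluation

variable {K : Type*} [NormedField K]

/-- `F` sums to `s` at `x`. -/
def HasEvalAt (x : K) (F : PowerSeries ℤ) (s : K) : Prop :=
  HasSum (fun n => ((PowerSeries.coeff n F : ℤ) : K) * x ^ n) s

theorem HasEvalAt.add {x s t : K} {F G : PowerSeries ℤ} (hF : HasEvalAt x F s)
    (hG : HasEvalAt x G t) : HasEvalAt x (F + G) (s + t) := by
  simpa [HasEvalAt, add_mul] using HasSum.add hF hG

theorem hasEvalAt_C (x : K) (a : ℤ) : HasEvalAt x (PowerSeries.C a) (a : K) := by
  have h := hasSum_single (f := fun n => ((PowerSeries.coeff n (PowerSeries.C a) : ℤ) : K) * x ^ n)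
    0 (fun n hn => by rw [PowerSeries.coeff_C, if_neg hn, Int.cast_zero, zero_mul])
  rwa [PowerSeries.coeff_zero_C, pow_zero, mul_one] at h

theorem hasEvalAt_X (x : K) : HasEvalAt x PowerSeries.X x := by
  have h := hasSum_single (f := fun n => ((PowerSeries.coeff n PowerSeries.X : ℤ) : K) * x ^ n)
    1 (fun n hn => by simp [PowerSeries.coeff_X, hn])
  rwa [PowerSeries.coeff_one_X, pow_one, Int.cast_one, one_mul] at h

variable (K) in
/-- Convergent series in `K` may be multiplied by the Cauchy product. -/
def HasCauchyProducts : Prop :=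
  ∀ (f g : ℕ → K) (a b : K), HasSum f a → HasSum g b →
    HasSum (fun n => ∑ ij ∈ Finset.HasAntidiagonal.antidiagonal n, f ij.1 * g ij.2) (a * b)

theorem HasEvalAt.mul (hK : HasCauchyProducts K) {x s t : K} {F G : PowerSeries ℤ}
    (hF : HasEvalAt x F s) (hG : HasEvalAt x G t) : HasEvalAt x (F * G) (s * t) := by
  have h := hK _ _ _ _ hF hG
  refine (congrArg (HasSum · (s * t)) (funext fun n => ?_)).mpr h
  rw [PowerSeries.coeff_mul, Int.cast_sum, Finset.sum_mul]
  refine Finset.sum_congr rfl fun ij hij => ?_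
  rw [← Finset.HasAntidiagonal.mem_antidiagonal.mp hij]
  push_cast
  ring

theorem HasCauchyProducts.cubic_of_hasSum (hK : HasCauchyProducts K) {x β : K}
    (hβ : HasSum (fun n : ℕ => ((3 * n).choose n : K) * x ^ n) β) :
    (27 * x - 4) * β ^ 3 + 3 * β + 1 = 0 := by
  have hS : HasEvalAt x tripleBinomialSeries β := by
    simpa [HasEvalAt, tripleBinomialSeries] using hβ
  have h := ((((hasEvalAt_C x 27).mul hK (hasEvalAt_X x)).add (hasEvalAt_C x (-4))).mul hK
    (hS.mul hK (hS.mul hK hS))).add (((hasEvalAt_C x 3).mul hK hS).add (hasEvalAt_C x 1))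
  have h0 : (PowerSeries.C 27 * PowerSeries.X + PowerSeries.C (-4)) *
      (tripleBinomialSeries * (tripleBinomialSeries * tripleBinomialSeries)) +
      (PowerSeries.C 3 * tripleBinomialSeries + PowerSeries.C 1) = 0 := by
    rw [← tripleBinomialSeries_cubic]
    simp only [map_neg, map_ofNat, map_one]
    ring
  rw [h0] at h
  have h1 : HasEvalAt x 0 (0 : K) := by simp [HasEvalAt, hasSum_zero]
  have h2 := HasSum.unique h h1
  push_cast at h2
  linear_combination h2

theorem hasCauchyProducts_of_isUltrametricDist [IsUltrametricDist K] : HasCauchyProducts K := by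
  intro f g a b hf hg
  have : NonarchimedeanRing K :=
    { is_nonarchimedean := NonarchimedeanAddGroup.is_nonarchimedean }
  have h := hf.mul_of_nonarchimedean hg
  rw [← Finset.HasAntidiagonal.sigmaAntidiagonalEquivProd.hasSum_iff] at h
  refine h.sigma fun n => ?_
  rw [← Finset.sum_coe_sort]
  exact hasSum_fintype _

theorem hasCauchyProducts_complex : HasCauchyProducts ℂ := by
  intro f g a b hf hg
  rw [← hf.tsum_eq, ← hg.tsum_eq,
    tsum_mul_tsum_eq_tsum_sum_antidiagonal_of_summable_norm hf.summable.norm hg.summable.norm]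
  exact (summable_norm_sum_mul_antidiagonal_of_summable_norm
    hf.summable.norm hg.summable.norm).of_norm.hasSum

end Evaluation

/-- A nonnegative real whose powers are bounded, up to a polynomial factor, by those of `b`
is at most `b`. -/
theorem le_of_forall_pow_le_rpow_mul_pow {a b c : ℝ} (hb : 0 ≤ b)
    (h : ∀ N : ℕ, a ^ N ≤ ((N : ℝ) + 1) ^ c * b ^ N) : a ≤ b := by
  by_contra! hba
  have ha0 : 0 < a := hb.trans_lt hba
  obtain ⟨k, hk⟩ := exists_nat_ge c
  have hr : |b / a| < 1 := by
    rwa [abs_of_nonneg (by positivity), div_lt_one ha0]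
  have hlim := (tendsto_pow_const_mul_const_pow_of_abs_lt_one k hr).const_mul ((2 : ℝ) ^ k)
  rw [mul_zero] at hlim
  obtain ⟨N, hN, hN1⟩ :=
    ((hlim.eventually_lt_const one_pos).and (Filter.eventually_ge_atTop 1)).exists
  have hN1' : (1 : ℝ) ≤ N := by exact_mod_cast hN1
  have h1 : ((N : ℝ) + 1) ^ c ≤ 2 ^ k * (N : ℝ) ^ k := by
    calc ((N : ℝ) + 1) ^ c ≤ ((N : ℝ) + 1) ^ (k : ℝ) :=
          Real.rpow_le_rpow_of_exponent_le (by linarith) hk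
      _ = ((N : ℝ) + 1) ^ k := Real.rpow_natCast _ _
      _ ≤ (2 * (N : ℝ)) ^ k := by gcongr; linarith
      _ = _ := mul_pow _ _ _
  have h2 : a ^ N ≤ 2 ^ k * (N : ℝ) ^ k * b ^ N :=
    (h N).trans (mul_le_mul_of_nonneg_right h1 (by positivity))
  rw [div_pow, ← mul_assoc, ← mul_div_assoc, div_lt_one (by positivity)] at hN
  linarith

section Archimedean

variable {K : Type*} [NormedField K]

theorem charZero_of_one_lt_norm_natCast {m : ℕ} (hm : 1 < ‖(m : K)‖) : CharZero K := by
  obtain ⟨p, hp⟩ := CharP.exists K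
  rcases CharP.char_is_prime_or_zero K p with hprime | rfl
  · have := Fact.mk hprime
    have hfrob : (m : K) ^ p = m := by
      have := ZMod.pow_card (m : ZMod p)
      have h := congrArg (ZMod.castHom dvd_rfl K) this
      simpa only [map_pow, map_natCast] using h
    have hlt : ‖(m : K)‖ ^ 1 < ‖(m : K)‖ ^ p := pow_lt_pow_right₀ hm hprime.one_lt
    rw [← norm_pow _ p, hfrob, pow_one] at hlt
    exact absurd hlt (lt_irrefl _)
  · exact CharP.charP_to_charZero K

theorem exists_rpow_norm_natCast_eq {m : ℕ} (hm : 1 < ‖(m : K)‖) :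
    ∃ c : ℝ, 0 < c ∧ ∀ n : ℕ, ‖(n : K)‖ ^ c = n := by
  have := charZero_of_one_lt_norm_natCast hm
  let f : AbsoluteValue ℚ ℝ :=
    (NormedField.toAbsoluteValue K).comp (f := algebraMap ℚ K) (algebraMap ℚ K).injective
  have hf (n : ℕ) : f n = ‖(n : K)‖ := by
    change ‖algebraMap ℚ K n‖ = _
    rw [map_natCast]
  have hub : ¬ ∀ n : ℕ, f n ≤ 1 := fun h => by
    have := h m
    rw [hf] at this
    linarith
  obtain ⟨c, hc, h⟩ := Rat.AbsoluteValue.exists_nat_rpow_iff_isEquiv.mpr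
    (Rat.AbsoluteValue.equiv_real_of_unbounded hub)
  exact ⟨c, hc, fun n => by simpa [hf] using h n⟩

theorem norm_add_rpow_le {c : ℝ} (hc : 0 < c) (h : ∀ n : ℕ, ‖(n : K)‖ ^ c = n) (x y : K) :
    ‖x + y‖ ^ c ≤ ‖x‖ ^ c + ‖y‖ ^ c := by
  refine le_of_forall_pow_le_rpow_mul_pow (c := c) (by positivity) fun N => ?_
  set B := ‖x‖ ^ c + ‖y‖ ^ c with hB
  have hB0 : 0 ≤ B := by positivity
  have hterm (k : ℕ) (hk : k ∈ Finset.range (N + 1)) :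
      ‖x ^ k * y ^ (N - k) * (N.choose k : K)‖ ≤ (B ^ N) ^ c⁻¹ := by
    rw [Real.le_rpow_inv_iff_of_pos (norm_nonneg _) (by positivity) hc, norm_mul, norm_mul,
      Real.mul_rpow (by positivity) (by positivity), Real.mul_rpow (by positivity) (by positivity),
      h, norm_pow, norm_pow, ← Real.rpow_pow_comm (norm_nonneg _),
      ← Real.rpow_pow_comm (norm_nonneg _), hB, add_pow]
    exact Finset.single_le_sum
      (f := fun k => (‖x‖ ^ c) ^ k * (‖y‖ ^ c) ^ (N - k) * (N.choose k : ℝ))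
      (fun _ _ => by positivity) hk
  have hsum : ‖x + y‖ ^ N ≤ (N + 1) * (B ^ N) ^ c⁻¹ := by
    rw [← norm_pow, add_pow]
    refine (norm_sum_le_of_le _ hterm).trans_eq ?_
    simp
  calc (‖x + y‖ ^ c) ^ N = (‖x + y‖ ^ N) ^ c := Real.rpow_pow_comm (norm_nonneg _) _ _
    _ ≤ ((N + 1) * (B ^ N) ^ c⁻¹) ^ c := Real.rpow_le_rpow (by positivity) hsum hc.le
    _ = ((N : ℝ) + 1) ^ c * B ^ N := by
      rw [Real.mul_rpow (by positivity) (by positivity), Real.rpow_inv_rpow (by positivity) hc.ne']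

/-- The absolute value `x ↦ ‖x‖ ^ c`, normalised to extend the usual one on the naturals. -/
noncomputable def normRpowAbsoluteValue {c : ℝ} (hc : 0 < c) (h : ∀ n : ℕ, ‖(n : K)‖ ^ c = n) :
    AbsoluteValue K ℝ where
  toFun x := ‖x‖ ^ c
  map_mul' x y := by rw [norm_mul, Real.mul_rpow (norm_nonneg _) (norm_nonneg _)]
  nonneg' x := by positivity
  eq_zero' x := by rw [Real.rpow_eq_zero (norm_nonneg _) hc.ne', norm_eq_zero]
  add_le' := norm_add_rpow_le hc h

/-- A complete normed field whose norm extends the usual one on the naturals embeds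
continuously into the complex numbers. -/
theorem exists_continuous_ringHom_complex_of_norm_natCast {L : Type*} [NormedField L]
    [CompleteSpace L] (h : ∀ n : ℕ, ‖(n : L)‖ = n) : ∃ φ : L →+* ℂ, Continuous φ := by
  have : CharZero L := ⟨fun a b hab => by
    have := congrArg norm hab
    rw [h, h] at this
    exact_mod_cast this⟩
  have hint (n : ℤ) : ‖(n : L)‖ = |(n : ℝ)| := by
    obtain ⟨k, rfl | rfl⟩ := n.eq_nat_or_neg <;> simp [h]
  have hrat (r : ℚ) : ‖algebraMap ℚ L r‖ = ‖r‖ := by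
    rw [eq_ratCast, Rat.cast_def, norm_div, hint, h, ← Rat.norm_cast_real,
      Real.norm_eq_abs, Rat.cast_def r, abs_div, Nat.abs_cast]
  have hiso : Isometry (algebraMap ℚ L) := AddMonoidHomClass.isometry_of_norm _ hrat
  have hui : IsUniformInducing (Rat.castHom ℝ) := Rat.isUniformEmbedding_coe_real.isUniformInducing
  have hdr : DenseRange (Rat.castHom ℝ) := Rat.isDenseEmbedding_coe_real.dense
  let ψ : ℝ →+* L := IsDenseInducing.extendRingHom hui hdr hiso.uniformContinuous
  have hψ : Continuous ψ :=
    (uniformContinuous_uniformly_extend hui hdr hiso.uniformContinuous).continuous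
  have hψrat (r : ℚ) : ψ r = algebraMap ℚ L r := by simp
  have hψnorm (r : ℝ) : ‖ψ r‖ = ‖r‖ := by
    refine hdr.induction_on r (isClosed_eq (by fun_prop) (by fun_prop)) fun q => ?_
    rw [Rat.coe_castHom, hψrat, hrat, Rat.norm_cast_real]
  let : NormedAlgebra ℝ L :=
    { ψ.toAlgebra with
      norm_smul_le := fun r x => by
        change ‖ψ r * x‖ ≤ _
        rw [norm_mul, hψnorm] }
  rcases NormedAlgebra.Real.nonempty_algEquiv_or L with ⟨⟨e⟩⟩ | ⟨⟨e⟩⟩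
  · have := e.symm.toLinearEquiv.finiteDimensional
    exact ⟨Complex.ofRealHom.comp (e : L →+* ℝ),
      Complex.continuous_ofReal.comp (e.toLinearMap.continuous_of_finiteDimensional)⟩
  · have := e.symm.toLinearEquiv.finiteDimensional
    exact ⟨(e : L →+* ℂ), e.toLinearMap.continuous_of_finiteDimensional⟩

/-- **Ostrowski's theorem**: an archimedean normed field embeds continuously into `ℂ`. -/
theorem exists_continuous_ringHom_complex {m : ℕ} (hm : 1 < ‖(m : K)‖) :
    ∃ φ : K →+* ℂ, Continuous φ := by
  obtain ⟨c, hc, h⟩ := exists_rpow_norm_natCast_eq hm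
  let v := normRpowAbsoluteValue hc h
  let ι : K →+* v.Completion :=
    UniformSpace.Completion.coeRingHom.comp (WithAbs.equiv v).symm.toRingHom
  have hι (x : K) : ‖ι x‖ = ‖x‖ ^ c := by
    refine (UniformSpace.Completion.norm_coe _).trans ?_
    rfl
  have hcont : Continuous ι := by
    refine continuous_of_continuousAt_zero ι ?_
    rw [ContinuousAt, map_zero, tendsto_zero_iff_norm_tendsto_zero]
    simp only [hι]
    have : Filter.Tendsto (fun x : K => ‖x‖ ^ c) (nhds 0) (nhds (‖(0 : K)‖ ^ c)) :=
      (continuous_norm.rpow_const fun _ => Or.inr hc.le).tendsto 0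
    rwa [norm_zero, Real.zero_rpow hc.ne'] at this
  obtain ⟨φ, hφ⟩ := exists_continuous_ringHom_complex_of_norm_natCast (L := v.Completion)
    fun n => by rw [← map_natCast ι, hι, h]
  exact ⟨φ.comp ι, hφ.comp hcont⟩

end Archimedean

/-- If `∑ (3n).choose n * xⁿ` converges to `β` in a normed field, then
`(27x - 4) β³ + 3β + 1 = 0`. -/
theorem cubic_of_hasSum {K : Type*} [NormedField K] {x β : K}
    (hβ : HasSum (fun n : ℕ => ((3 * n).choose n : K) * x ^ n) β) :
    (27 * x - 4) * β ^ 3 + 3 * β + 1 = 0 := by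
  by_cases hna : ∀ n : ℕ, ‖(n : K)‖ ≤ 1
  · have := IsUltrametricDist.isUltrametricDist_of_forall_norm_natCast_le_one hna
    exact hasCauchyProducts_of_isUltrametricDist.cubic_of_hasSum hβ
  · push Not at hna
    obtain ⟨m, hm⟩ := hna
    obtain ⟨φ, hφ⟩ := exists_continuous_ringHom_complex hm
    have h := hβ.map φ hφ
    simp only [Function.comp_def, map_mul, map_pow, map_natCast] at h
    refine φ.injective ?_
    simpa only [map_add, map_sub, map_mul, map_pow, map_ofNat, map_one, map_zero] using
      hasCauchyProducts_complex.cubic_of_hasSum h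


theorem discriminant_root_cubic
    {K : Type*} [NormedField K] (h27 : (27 : K) ≠ 0)
    (p q : K) (hp : p ≠ 0) (Δ : K) (hΔ : Δ = -4 * p ^ 3 - 27 * q ^ 2)
    (β : K)
    (hβ : HasSum (fun n : ℕ => ((3 * n).choose n : K) * (-Δ / (27 * p ^ 3)) ^ n) β) :
    ((3 * q / p) * β) ^ 3 + p * ((3 * q / p) * β) + q = 0 := by
  have hx : -Δ / (27 * p ^ 3) = 4 / 27 + q ^ 2 / p ^ 3 := by
    rw [hΔ]
    field_simp
    ring
  have h := cubic_of_hasSum hβ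
  rw [hx] at h
  have hroot : ((3 * q / p) * β) ^ 3 + p * ((3 * q / p) * β) + q =
      q * ((27 * (4 / 27 + q ^ 2 / p ^ 3) - 4) * β ^ 3 + 3 * β + 1) := by
    field_simp
    ring
  rw [hroot, h, mul_zero]
end

section
/- Let p, q ∈ ℝ with p ≠ 0 and q ≠ 0, and suppose Δ := −4p³ − 27q² > 0. Then both the discriminant term function n ↦ binom(3n,n)·(−Δ/(27p³))ⁿ and the trinomial term function m ↦ A_m(3,1)·(−q²/p³)ᵐ are summable over ℝ (the two series converge unconditionally). Moreover, writing γ for the sum of the trinomial series, the trinomial root α_t := −(q/p)·γ satisfies α_t³ + p·α_t + q = 0 and α_t has the same sign as q (that is, q·α_t > 0). -/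
open Finset in
/-- The ternary Raney number `r / (3 m + r) * choose (3 m + r) m`, defined by its Pascal-type
recurrence. -/
def raney : ℕ → ℕ → ℕ
  | 0, _ => 1
  | m + 1, r => ∑ i ∈ range r, raney m (i + 3)

lemma raney_zero (r : ℕ) : raney 0 r = 1 := rfl

lemma raney_succ_zero (m : ℕ) : raney (m + 1) 0 = 0 := rfl

lemma raney_succ_succ (m r : ℕ) : raney (m + 1) (r + 1) = raney (m + 1) r + raney m (r + 3) :=
  Finset.sum_range_succ _ _

open Finset in
lemma sum_antidiagonal_raney_mul_raney (n r s : ℕ) :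
    ∑ kl ∈ antidiagonal n, raney kl.1 r * raney kl.2 s = raney n (r + s) := by
  induction n generalizing r s with
  | zero => simp [raney_zero]
  | succ n ihn =>
    induction r with
    | zero => simp [Nat.sum_antidiagonal_succ, raney_zero, raney_succ_zero]
    | succ r ihr =>
      rw [Nat.sum_antidiagonal_succ] at ihr ⊢
      simp only [raney_zero, raney_succ_succ, add_mul, sum_add_distrib, ihn] at ihr ⊢
      rw [← add_assoc, ihr, add_right_comm r 1 s, raney_succ_succ, add_right_comm r 3 s]

open Nat in
lemma raney_mul_factorial_mul_factorial (m r : ℕ) :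
    raney m (r + 1) * (m ! * (2 * m + r + 1)!) = (r + 1) * (3 * m + r)! := by
  induction m generalizing r with
  | zero => simp [raney_zero, factorial_succ]
  | succ m ihm =>
    induction r with
    | zero =>
      have h := ihm 2
      simp only [raney_succ_succ, raney_succ_zero, factorial_succ,
        show 2 * (m + 1) + 0 + 1 = 2 * m + 2 + 1 by ring,
        show 3 * (m + 1) + 0 = 3 * m + 2 + 1 by ring] at h ⊢
      linear_combination (m + 1) * h
    | succ r ihr =>
      have h := ihm (r + 3)
      rw [raney_succ_succ]
      simp only [factorial_succ,
        show 2 * (m + 1) + (r + 1) + 1 = 2 * m + r + 3 + 1 by ring,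
        show 2 * (m + 1) + r + 1 = 2 * m + r + 3 by ring,
        show 2 * m + (r + 3) + 1 = 2 * m + r + 3 + 1 by ring,
        show 3 * (m + 1) + (r + 1) = 3 * m + r + 3 + 1 by ring,
        show 3 * m + (r + 3) = 3 * m + r + 3 by ring,
        show 3 * (m + 1) + r = 3 * m + r + 3 by ring,
        show r + 1 + 3 = r + 3 + 1 by ring] at h ihr ⊢
      linear_combination (2 * m + r + 4) * ihr + (m + 1) * h

lemma raney_one_eq_choose_div (m : ℕ) :
    (raney m 1 : ℝ) = ((3 * m).choose m : ℝ) / (2 * m + 1) := by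
  have h := raney_mul_factorial_mul_factorial m 0
  have hc := Nat.choose_mul_factorial_mul_factorial (show m ≤ 3 * m by omega)
  rw [show 3 * m - m = 2 * m by omega] at hc
  simp only [add_zero, zero_add, one_mul, ← hc, Nat.factorial_succ] at h
  rw [eq_div_iff (by positivity)]
  have hpos : 0 < m.factorial * (2 * m).factorial := by positivity
  have key : raney m 1 * (2 * m + 1) = (3 * m).choose m :=
    Nat.eq_of_mul_eq_mul_right hpos (by linear_combination h)
  exact_mod_cast key

lemma choose_three_mul_mul_four_pow_le (n : ℕ) : (3 * n).choose n * 4 ^ n ≤ 27 ^ n := by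
  have h := add_pow 1 2 (3 * n)
  have hle := Finset.single_le_sum (s := Finset.range (3 * n + 1)) (a := n)
    (f := fun k => 1 ^ k * 2 ^ (3 * n - k) * (3 * n).choose k)
    (fun _ _ => Nat.zero_le _) (by simp; omega)
  simp only [Nat.cast_id] at h
  rw [← h, show 3 * n - n = 2 * n by omega, pow_mul, pow_mul] at hle
  norm_num at hle
  linarith

lemma summable_choose_three_mul_mul_pow {x : ℝ} (hx : |x| < 4 / 27) :
    Summable fun n : ℕ => ((3 * n).choose n : ℝ) * x ^ n := by
  refine Summable.of_norm_bounded (g := fun n => (27 / 4 * |x|) ^ n)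
    (summable_geometric_of_lt_one (by positivity) (by linarith)) fun n => ?_
  have h : ((3 * n).choose n : ℝ) * 4 ^ n ≤ 27 ^ n := by
    exact_mod_cast choose_three_mul_mul_four_pow_le n
  rw [norm_mul, norm_pow, Real.norm_natCast, Real.norm_eq_abs, mul_pow, div_pow]
  gcongr
  rwa [le_div_iff₀ (by positivity)]

lemma summable_raney_one_mul_pow {x : ℝ} (hx : |x| < 4 / 27) :
    Summable fun m : ℕ => (raney m 1 : ℝ) * x ^ m := by
  refine Summable.of_norm_bounded (summable_choose_three_mul_mul_pow hx).norm fun m => ?_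
  rw [raney_one_eq_choose_div, norm_mul, norm_mul]
  gcongr
  rw [Real.norm_natCast, Real.norm_of_nonneg (by positivity)]
  exact div_le_self (by positivity) (by linarith [m.cast_nonneg (α := ℝ)])

open Finset in
lemma HasSum.raney_mul {x a b : ℝ} {r s : ℕ}
    (hr : HasSum (fun m : ℕ => (raney m r : ℝ) * x ^ m) a)
    (hs : HasSum (fun m : ℕ => (raney m s : ℝ) * x ^ m) b) :
    HasSum (fun m : ℕ => (raney m (r + s) : ℝ) * x ^ m) (a * b) := by
  have hterm (n : ℕ) : ∑ kl ∈ antidiagonal n,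
      (raney kl.1 r : ℝ) * x ^ kl.1 * ((raney kl.2 s : ℝ) * x ^ kl.2) =
        (raney n (r + s) : ℝ) * x ^ n := by
    rw [← sum_antidiagonal_raney_mul_raney, Nat.cast_sum, sum_mul]
    refine sum_congr rfl fun kl hkl => ?_
    rw [← mem_antidiagonal.mp hkl, pow_add]
    push_cast
    ring
  have hsum := (summable_norm_sum_mul_antidiagonal_of_summable_norm
    hr.summable.norm hs.summable.norm).of_norm
  have htsum := tsum_mul_tsum_eq_tsum_sum_antidiagonal_of_summable_norm
    hr.summable.norm hs.summable.norm
  simp only [hterm] at hsum htsum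
  rw [hr.tsum_eq, hs.tsum_eq] at htsum
  exact htsum ▸ hsum.hasSum

lemma HasSum.raney_one_eq {x γ : ℝ} (h : HasSum (fun m : ℕ => (raney m 1 : ℝ) * x ^ m) γ) :
    γ = 1 + x * γ ^ 3 := by
  have h3 := ((h.raney_mul h).raney_mul h).mul_left x
  have hsucc : HasSum (fun m : ℕ => (raney (m + 1) 1 : ℝ) * x ^ (m + 1)) (x * (γ * γ * γ)) := by
    refine h3.congr_fun fun m => ?_
    rw [raney_succ_succ, raney_succ_zero, pow_succ]
    norm_num
    ring
  have := h.unique ((hasSum_nat_add_iff 1).mp hsucc)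
  simp only [Finset.sum_range_one, raney_zero] at this
  linear_combination this

theorem casus_irreducibilis_convergence
    (p q : ℝ) (hp : p ≠ 0) (hq : q ≠ 0) (Δ : ℝ) (hΔ : Δ = -4 * p ^ 3 - 27 * q ^ 2)
    (hΔpos : 0 < Δ) :
    Summable (fun n : ℕ => ((3 * n).choose n : ℝ) * (-Δ / (27 * p ^ 3)) ^ n) ∧
    Summable (fun m : ℕ => (((3 * m).choose m : ℝ) / (2 * m + 1)) * (-q ^ 2 / p ^ 3) ^ m) ∧
    ∀ γ : ℝ,
      HasSum (fun m : ℕ => (((3 * m).choose m : ℝ) / (2 * m + 1)) * (-q ^ 2 / p ^ 3) ^ m) γ →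
      (-(q / p) * γ) ^ 3 + p * (-(q / p) * γ) + q = 0 ∧ q * (-(q / p) * γ) > 0 := by
  have hq2 : 0 < q ^ 2 := by positivity
  have hp3 : p ^ 3 < 0 := by linarith
  have hpneg : p < 0 := (Odd.pow_neg_iff (by decide)).mp hp3
  have hx0 : 0 < -q ^ 2 / p ^ 3 := div_pos_of_neg_of_neg (by linarith) hp3
  have hΔx : -Δ / (27 * p ^ 3) = 4 / 27 - -q ^ 2 / p ^ 3 := by
    rw [hΔ]
    field_simp
    ring
  have hΔx0 : 0 < -Δ / (27 * p ^ 3) := div_pos_of_neg_of_neg (by linarith) (by linarith)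
  simp only [← raney_one_eq_choose_div]
  refine ⟨summable_choose_three_mul_mul_pow (by rw [abs_of_pos hΔx0]; linarith),
    summable_raney_one_mul_pow (by rw [abs_of_pos hx0]; linarith), fun γ hγ => ?_⟩
  have hγpos : 0 < γ := by
    have hle := hγ.nonneg (fun m => by positivity)
    rw [hγ.raney_one_eq]
    positivity
  constructor
  · have heq := hγ.raney_one_eq
    have hcube : (-(q / p) * γ) ^ 3 = q * (-q ^ 2 / p ^ 3 * γ ^ 3) := by
      field_simp
    have hlin : p * (-(q / p) * γ) = -q * γ := by
      field_simp
    rw [hcube, hlin]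
    linear_combination -q * heq
  · rw [show q * (-(q / p) * γ) = -q ^ 2 / p * γ by ring]
    exact mul_pos (div_pos_of_neg_of_neg (by linarith) hpneg) hγpos
end

section
/- Let K be a normed field of characteristic 3 and let c₁, c₂, c₃ ∈ K with c₁ ≠ 0. Set Δ := c₁²c₂² − c₁³c₃ − c₂³ (the discriminant of t³ + c₁t² + c₂t + c₃ in characteristic 3). Define integers b₀ := 1 and b_m := −binom(3m−1, m)/(3m−1) for m ≥ 1 (these are the coefficients of the generalized binomial series 𝔅_{3,−1}; each b_m is an integer). If the series ∑_{m≥0} b_m·(Δ/c₁⁶)ᵐ converges unconditionally to β ∈ K (HasSum, with b_m cast into K), then α := c₂/c₁ − c₁·β satisfies α³ + c₁·α² + c₂·α + c₃ = 0. -/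
/-- Coefficients of the generalized binomial series `𝔅₃,₋₁`:
`b₀ = 1` and `b_m = -binom(3m-1, m)/(3m-1)` for `m ≥ 1` (the division is exact). -/
def fussCatalanNegOne (m : ℕ) : ℤ :=
  if m = 0 then 1 else -(((3 * m - 1).choose m : ℤ)) / (3 * m - 1)

open PowerSeries in
/-- In characteristic `3`, the coefficients `-binom(3m-1, m)/(3m-1)` are just `binom(3m-1, m)`. -/
theorem fussCatalanNegOne_succ_cast (k : ℕ) :
    (fussCatalanNegOne (k + 1) : ZMod 3) = ((3 * k + 2).choose (k + 1) : ℕ) := by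
  have hdvd : 3 * k + 2 ∣ (3 * k + 2).choose (k + 1) := by
    have hcop : Nat.Coprime (3 * k + 2) (k + 1) := by
      rw [← Nat.isCoprime_iff_coprime]
      exact ⟨-1, 3, by push_cast; ring⟩
    exact hcop.dvd_of_dvd_mul_right ⟨_, (Nat.add_one_mul_choose_eq (3 * k + 1) k).symm⟩
  obtain ⟨t, ht⟩ := hdvd
  have hb : fussCatalanNegOne (k + 1) = -(t : ℤ) := by
    have h1 : 3 * (k + 1) - 1 = 3 * k + 2 := by omega
    have h2 : (3 * ((k + 1 : ℕ) : ℤ) - 1) = 3 * k + 2 := by push_cast; ring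
    rw [fussCatalanNegOne, if_neg k.succ_ne_zero, h1, h2, ht]
    push_cast
    rw [← mul_neg]
    exact Int.mul_ediv_cancel_left _ (by omega)
  have h3 : (3 : ZMod 3) = 0 := rfl
  rw [hb, ht]
  push_cast
  linear_combination (-(t : ZMod 3) * (k + 1)) * h3

theorem fussCatalanNegOne_zero : fussCatalanNegOne 0 = 1 := by simp [fussCatalanNegOne]

/-- Lucas' theorem for the prime `3`, in terms of base-`3` digits. -/
theorem choose_three_mul_add_cast (n k a b : ℕ) (ha : a < 3) (hb : b < 3) :
    ((3 * n + a).choose (3 * k + b) : ZMod 3) = (a.choose b : ZMod 3) * (n.choose k : ZMod 3) := by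
  have : Fact (Nat.Prime 3) := ⟨Nat.prime_three⟩
  have h := (ZMod.natCast_eq_natCast_iff _ _ _).2
    (Choose.choose_modEq_choose_mod_mul_choose_div_nat (p := 3) (n := 3 * n + a) (k := 3 * k + b))
  rw [show (3 * n + a) % 3 = a by omega, show (3 * k + b) % 3 = b by omega,
    show (3 * n + a) / 3 = n by omega, show (3 * k + b) / 3 = k by omega] at h
  rw [h, Nat.cast_mul]

theorem choose_three_mul_self_cast (q : ℕ) :
    ((3 * q).choose q : ZMod 3) = if q = 0 then 1 else 0 := by
  rcases q with _ | k
  · simp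
  · have h := Nat.add_one_mul_choose_eq (3 * k + 2) k
    have h' : (3 * (k + 1)).choose (k + 1) = 3 * (3 * k + 2).choose k := by
      apply Nat.eq_of_mul_eq_mul_right k.succ_pos
      rw [Nat.succ_eq_add_one, mul_add_one 3 k, ← h]
      ring
    have h3 : (3 : ZMod 3) = 0 := rfl
    rw [h', if_neg k.succ_ne_zero, Nat.cast_mul, Nat.cast_ofNat, h3, zero_mul]

theorem fussCatalanNegOne_three_mul_cast (q : ℕ) :
    (fussCatalanNegOne (3 * q) : ZMod 3) = fussCatalanNegOne q := by
  rcases q with _ | k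
  · rfl
  · rw [show 3 * (k + 1) = (3 * k + 2) + 1 by ring, fussCatalanNegOne_succ_cast,
      fussCatalanNegOne_succ_cast,
      show 3 * k + 2 + 1 = 3 * (k + 1) + 0 by ring,
      choose_three_mul_add_cast _ _ 2 0 (by norm_num) (by norm_num)]
    simp

theorem fussCatalanNegOne_three_mul_add_one_cast (q : ℕ) :
    (fussCatalanNegOne (3 * q + 1) : ZMod 3) = if q = 0 then -1 else 0 := by
  rw [fussCatalanNegOne_succ_cast, choose_three_mul_add_cast _ _ 2 1 (by norm_num) (by norm_num),
    choose_three_mul_self_cast]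
  split_ifs
  · rfl
  · simp

theorem fussCatalanNegOne_three_mul_add_two_cast (q : ℕ) :
    (fussCatalanNegOne (3 * q + 2) : ZMod 3) = ((3 * q + 1).choose q : ℕ) := by
  rw [fussCatalanNegOne_succ_cast, add_assoc,
    choose_three_mul_add_cast _ _ 2 (1 + 1) (by norm_num) (by norm_num)]
  simp

open PowerSeries in
theorem PowerSeries.expand_three_eq_pow (f : (ZMod 3)⟦X⟧) :
    PowerSeries.expand 3 three_ne_zero f = f ^ 3 := by
  have : Fact (Nat.Prime 3) := ⟨Nat.prime_three⟩
  have h := MvPowerSeries.map_frobenius_expand 3 three_ne_zero (f := f)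
  rw [ZMod.frobenius_zmod, MvPowerSeries.map_id] at h
  exact h

open PowerSeries in
theorem PowerSeries.coeff_pow_three (f : (ZMod 3)⟦X⟧) (n : ℕ) :
    coeff n (f ^ 3) = if 3 ∣ n then coeff (n / 3) f else 0 := by
  rw [← PowerSeries.expand_three_eq_pow, coeff_expand]

open PowerSeries in
/-- The reduction modulo `3` of the series `∑ binom(3m+1, m) Xᵐ`. -/
theorem mk_choose_eq_one_add_X_mul_pow_three :
    (mk fun m => ((3 * m + 1).choose m : ZMod 3)) =
      1 + X * (mk fun m => ((3 * m + 1).choose m : ZMod 3)) ^ 3 := by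
  ext n
  obtain ⟨s, rfl | rfl | rfl⟩ : ∃ s, n = 3 * s ∨ n = 3 * s + 1 ∨ n = 3 * s + 2 :=
    ⟨n / 3, by omega⟩
  · have h := choose_three_mul_add_cast (3 * s) s 1 0 (by norm_num) (by norm_num)
    rw [choose_three_mul_self_cast] at h
    rw [map_add, coeff_mk]
    rcases s with _ | k
    · simp
    · rw [show 3 * (k + 1) = (3 * k + 2) + 1 by ring, coeff_succ_X_mul, coeff_pow_three,
        if_neg (by omega), coeff_one, if_neg (by omega)]
      simpa [mul_add] using h
  · have h := choose_three_mul_add_cast (3 * s + 1) s 1 1 (by norm_num) (by norm_num)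
    rw [map_add, coeff_mk, coeff_succ_X_mul, coeff_pow_three, if_pos (by omega), coeff_one,
      if_neg (by omega), h, coeff_mk, show 3 * s / 3 = s by omega]
    simp
  · have h := choose_three_mul_add_cast (3 * s + 2) s 1 2 (by norm_num) (by norm_num)
    rw [map_add, coeff_mk, coeff_succ_X_mul, coeff_pow_three, if_neg (by omega), coeff_one,
      if_neg (by omega), h]
    simp

open PowerSeries in
theorem mk_fussCatalanNegOne_eq :
    (mk fun m => (fussCatalanNegOne m : ZMod 3)) =
      (mk fun m => (fussCatalanNegOne m : ZMod 3)) ^ 3 - X +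
        X * (X * (mk fun m => ((3 * m + 1).choose m : ZMod 3)) ^ 3) := by
  ext n
  obtain ⟨s, rfl | rfl | rfl⟩ : ∃ s, n = 3 * s ∨ n = 3 * s + 1 ∨ n = 3 * s + 2 :=
    ⟨n / 3, by omega⟩
  · have h := fussCatalanNegOne_three_mul_cast s
    rw [map_add, map_sub, coeff_mk, coeff_pow_three, if_pos (by omega), coeff_X,
      if_neg (by omega), show 3 * s / 3 = s by omega, coeff_mk, h]
    rcases s with _ | k
    · simp
    · rw [show 3 * (k + 1) = (3 * k + 1) + 1 + 1 by ring, coeff_succ_X_mul, coeff_succ_X_mul,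
        coeff_pow_three, if_neg (by omega)]
      simp
  · have h := fussCatalanNegOne_three_mul_add_one_cast s
    rw [map_add, map_sub, coeff_mk, coeff_pow_three, if_neg (by omega), coeff_X, h,
      coeff_succ_X_mul]
    rcases s with _ | k
    · simp
    · rw [show 3 * (k + 1) = (3 * k + 2) + 1 by ring, coeff_succ_X_mul, coeff_pow_three,
        if_neg (show ¬ 3 ∣ 3 * k + 2 by omega)]
      simp
  · have h := fussCatalanNegOne_three_mul_add_two_cast s
    rw [map_add, map_sub, coeff_mk, coeff_pow_three, if_neg (by omega), coeff_X,
      if_neg (by omega), h, coeff_succ_X_mul, coeff_succ_X_mul, coeff_pow_three,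
      if_pos (by omega), coeff_mk, show 3 * s / 3 = s by omega]
    simp

open PowerSeries in
/-- The reduction of `𝔅₃,₋₁` modulo `3` satisfies `F² = F³ + X`. -/
theorem mk_fussCatalanNegOne_sq :
    (mk fun m => (fussCatalanNegOne m : ZMod 3)) ^ 2 =
      (mk fun m => (fussCatalanNegOne m : ZMod 3)) ^ 3 + X := by
  have : Fact (Nat.Prime 3) := ⟨Nat.prime_three⟩
  have hQ := mk_choose_eq_one_add_X_mul_pow_three
  have hF := mk_fussCatalanNegOne_eq
  have hF0 : constantCoeff (mk fun m => (fussCatalanNegOne m : ZMod 3)) = 1 := by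
    rw [← coeff_zero_eq_constantCoeff_apply, coeff_mk, fussCatalanNegOne_zero, Int.cast_one]
  have hQ0 : constantCoeff (mk fun m => ((3 * m + 1).choose m : ZMod 3)) = 1 := by
    rw [← coeff_zero_eq_constantCoeff_apply, coeff_mk]
    simp
  generalize (mk fun m => (fussCatalanNegOne m : ZMod 3)) = F at *
  generalize (mk fun m => ((3 * m + 1).choose m : ZMod 3)) = Q at *
  have h3 : (3 : (ZMod 3)⟦X⟧) = 0 := by
    have : (3 : ZMod 3) = 0 := rfl
    rw [← map_ofNat (C (R := ZMod 3)) 3, this, map_zero]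
  have hprod : (F * Q - 1) * (Q ^ 2 - (F * Q - 1) ^ 2) = 0 := by
    linear_combination Q ^ 3 * hF + (2 - Q - X * Q ^ 3) * hQ +
      (F ^ 2 * Q ^ 2 - F * Q + 1 - Q) * h3
  have hFQ : F * Q = 1 := by
    rcases mul_eq_zero.1 hprod with h | h
    · exact sub_eq_zero.1 h
    · have := congrArg constantCoeff h
      simp [hF0, hQ0] at this
  linear_combination F ^ 3 * hQ + (X * (1 + F * Q + F ^ 2 * Q ^ 2) - F ^ 2) * hFQ

theorem norm_intCast_le_one_of_charP_three {K : Type*} [NormedField K] [CharP K 3] (n : ℤ) :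
    ‖(n : K)‖ ≤ 1 := by
  have : Fact (Nat.Prime 3) := ⟨Nat.prime_three⟩
  have hK : (n : K) ^ 3 = n := by rw [← frobenius_def, map_intCast]
  by_contra! hlt
  have := congrArg norm hK
  rw [norm_pow] at this
  nlinarith [sq_nonneg ‖(n : K)‖]

open Filter Topology in
/-- If the specialised series `𝔅₃,₋₁(z)` converges in characteristic `3`, then `‖z‖ < 1`. -/
theorem norm_lt_one_of_summable_fussCatalanNegOne {K : Type*} [NormedField K] [CharP K 3] {z : K}
    (h : Summable fun m : ℕ => (fussCatalanNegOne m : K) * z ^ m) : ‖z‖ < 1 := by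
  have hb (k : ℕ) : (fussCatalanNegOne (3 ^ k) : ZMod 3) = -1 := by
    induction k with
    | zero => simpa using fussCatalanNegOne_three_mul_add_one_cast 0
    | succ k ih => rw [pow_succ', fussCatalanNegOne_three_mul_cast, ih]
  have hbK (k : ℕ) : (fussCatalanNegOne (3 ^ k) : K) = -1 := by
    have := congrArg (ZMod.castHom (dvd_refl 3) K) (hb k)
    simpa using this
  have ht := (h.tendsto_atTop_zero.comp
    (tendsto_pow_atTop_atTop_of_one_lt (r := 3) (by norm_num))).norm
  simp only [Function.comp_def, hbK, norm_mul, norm_neg, norm_one, one_mul, norm_pow,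
    norm_zero] at ht
  by_contra! hz
  exact absurd (ge_of_tendsto' ht fun k => one_le_pow₀ hz) (by norm_num)

/-- In characteristic `3`, a value `β` of `𝔅₃,₋₁` at `z` satisfies `β² = β³ + z`. -/
theorem sq_eq_of_hasSum_fussCatalanNegOne {K : Type*} [NormedField K] [CharP K 3] {z β : K}
    (h : HasSum (fun m : ℕ => (fussCatalanNegOne m : K) * z ^ m) β) : β ^ 2 = β ^ 3 + z := by
  have : Fact (Nat.Prime 3) := ⟨Nat.prime_three⟩
  have hz := norm_lt_one_of_summable_fussCatalanNegOne h.summable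
  have hnorm : Summable fun m : ℕ => ‖(fussCatalanNegOne m : K) * z ^ m‖ := by
    refine Summable.of_nonneg_of_le (fun _ => norm_nonneg _) (fun m => ?_)
      (summable_geometric_of_lt_one (norm_nonneg z) hz)
    rw [norm_mul, norm_pow]
    exact mul_le_of_le_one_left (by positivity) (norm_intCast_le_one_of_charP_three _)
  have hcoeff (n : ℕ) : (∑ kl ∈ Finset.HasAntidiagonal.antidiagonal n,
      (fussCatalanNegOne kl.1 : K) * (fussCatalanNegOne kl.2 : K)) =
        (if 3 ∣ n then (fussCatalanNegOne (n / 3) : K) else 0) + if n = 1 then 1 else 0 := by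
    have h := congrArg (PowerSeries.coeff n) mk_fussCatalanNegOne_sq
    rw [map_add, PowerSeries.coeff_pow_three, sq, PowerSeries.coeff_mul,
      PowerSeries.coeff_X] at h
    simp only [PowerSeries.coeff_mk] at h
    have h' := congrArg (ZMod.castHom (dvd_refl 3) K) h
    simpa only [map_sum, map_add, map_mul, map_intCast, apply_ite (ZMod.castHom (dvd_refl 3) K),
      map_zero, map_one] using h'
  have hsq : HasSum (fun n : ℕ =>
      ((if 3 ∣ n then (fussCatalanNegOne (n / 3) : K) else 0) + if n = 1 then 1 else 0) * z ^ n)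
      (β ^ 2) := by
    have hs := summable_sum_mul_antidiagonal_of_summable_norm' hnorm h.summable hnorm h.summable
    have ht := tsum_mul_tsum_eq_tsum_sum_antidiagonal_of_summable_norm' hnorm h.summable hnorm
      h.summable
    have := hs.hasSum
    rw [← ht, h.tsum_eq, ← sq] at this
    refine this.congr_fun ?_
    intro n
    rw [← hcoeff, Finset.sum_mul]
    refine Finset.sum_congr rfl fun kl hkl => ?_
    rw [← Finset.HasAntidiagonal.mem_antidiagonal.1 hkl, pow_add]
    ring
  have hcube : HasSum (fun n : ℕ =>
      (if 3 ∣ n then (fussCatalanNegOne (n / 3) : K) else 0) * z ^ n) (β ^ 3) := by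
    have hf : HasSum (fun m : ℕ => (fussCatalanNegOne m : K) * z ^ (3 * m)) (β ^ 3) := by
      have hfrob (n : ℤ) : (n : K) ^ 3 = n := by rw [← frobenius_def, map_intCast]
      have hcont : Continuous (frobenius K 3) := continuous_pow 3
      simpa only [Function.comp_def, frobenius_def, mul_pow, pow_mul', hfrob] using
        h.map (frobenius K 3) hcont
    have hinj : Function.Injective fun m : ℕ => 3 * m := fun a b hab => by simpa using hab
    refine (hinj.hasSum_iff ?_).1 (by simpa [Function.comp_def] using hf)
    intro n hn
    rw [if_neg, zero_mul]
    rintro ⟨m, rfl⟩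
    exact hn ⟨m, rfl⟩
  have hX : HasSum (fun n : ℕ => (if n = 1 then (1 : K) else 0) * z ^ n) z := by
    have := hasSum_single (f := fun n : ℕ => (if n = 1 then (1 : K) else 0) * z ^ n) 1
      fun n hn => by simp [hn]
    simpa using this
  refine hsq.unique ?_
  simpa only [add_mul] using hcube.add hX

theorem discriminant_root_char_three
    {K : Type*} [NormedField K] (hchar : ringChar K = 3)
    (c₁ c₂ c₃ : K) (hc₁ : c₁ ≠ 0) (Δ : K)
    (hΔ : Δ = c₁ ^ 2 * c₂ ^ 2 - c₁ ^ 3 * c₃ - c₂ ^ 3)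
    (β : K)
    (hβ : HasSum (fun m : ℕ => (fussCatalanNegOne m : K) * (Δ / c₁ ^ 6) ^ m) β)
    (α : K) (hα : α = c₂ / c₁ - c₁ * β) :
    α ^ 3 + c₁ * α ^ 2 + c₂ * α + c₃ = 0 := by
  have : CharP K 3 := ringChar.of_eq hchar
  have h3 : (3 : K) = 0 := by exact_mod_cast CharP.cast_eq_zero K 3
  have h := sq_eq_of_hasSum_fussCatalanNegOne hβ
  obtain ⟨a, rfl⟩ : ∃ a, c₂ = a * c₁ := ⟨c₂ / c₁, (div_mul_cancel₀ _ hc₁).symm⟩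
  have hz : c₁ ^ 3 * (Δ / c₁ ^ 6) = c₁ * a ^ 2 - c₃ - a ^ 3 := by
    rw [hΔ]
    field_simp
  rw [mul_div_cancel_right₀ _ hc₁] at hα
  rw [hα]
  linear_combination c₁ ^ 3 * h + hz +
    (c₁ * a ^ 2 - a ^ 2 * c₁ * β + a * c₁ ^ 2 * β ^ 2 - a * c₁ ^ 2 * β) * h3
end

section
/- Let s ∈ ℤ[[X]] be the formal power series whose coefficient of Xⁿ is the central binomial-type coefficient binom(3n,n). Then the identity (4 − 27·X)·s³ = 1 + 3·s holds in the ring ℤ[[X]] of formal power series with integer coefficients. -/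
open PowerSeries in
/-- The functional equation `T = 1 + X * T ^ 3` has a power series solution. -/
theorem exists_powerSeries_eq_one_add_X_mul_cube :
    ∃ T : PowerSeries ℤ, T = 1 + X * T ^ 3 := by
  let p : ℕ → PowerSeries ℤ := fun n => (fun f => 1 + X * f ^ 3)^[n] 1
  have p_succ (n : ℕ) : p (n + 1) = 1 + X * p n ^ 3 :=
    Function.iterate_succ_apply' _ _ _
  have step (n : ℕ) : (X : PowerSeries ℤ) ^ (n + 1) ∣ p (n + 1) - p n := by
    induction n with
    | zero => exact ⟨1, by rw [p_succ]; simp [p]⟩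
    | succ n ih =>
      rw [p_succ (n + 1)]
      nth_rewrite 2 [p_succ n]
      rw [add_sub_add_left_eq_sub, ← mul_sub, pow_succ']
      exact mul_dvd_mul_left _ (ih.trans (sub_dvd_pow_sub_pow _ _ 3))
  have stable (m k : ℕ) : coeff m (p (m + k)) = coeff m (p m) := by
    induction k with
    | zero => rfl
    | succ k ih =>
      have h := X_pow_dvd_iff.mp (step (m + k)) m (by omega)
      rw [map_sub, sub_eq_zero] at h
      rw [← ih, ← h, add_assoc]
  let T : PowerSeries ℤ := mk fun n => coeff n (p n)
  have approx (n : ℕ) : (X : PowerSeries ℤ) ^ (n + 1) ∣ T - p n := by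
    rw [X_pow_dvd_iff]
    intro m hm
    obtain ⟨k, rfl⟩ := Nat.exists_eq_add_of_le (Nat.lt_succ_iff.mp hm)
    rw [map_sub, stable, coeff_mk, sub_self]
  refine ⟨T, sub_eq_zero.mp (ext fun n => ?_)⟩
  have h : (X : PowerSeries ℤ) ^ (n + 1) ∣ T - (1 + X * T ^ 3) := by
    have h₁ := (pow_dvd_pow X (Nat.le_succ (n + 1))).trans (approx (n + 1))
    have h₂ := ((approx n).trans (sub_dvd_pow_sub_pow _ _ 3)).mul_left X
    convert h₁.sub h₂ using 1
    rw [p_succ]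
    ring
  exact X_pow_dvd_iff.mp h n n.lt_succ_self

open PowerSeries in
/-- The power series `T / (3 - 2 * T)`, where `T = 1 + X * T ^ 3`, satisfies a linear
differential equation of order two. -/
theorem derivative_eq_of_eq_one_add_X_mul_cube {S T : PowerSeries ℤ}
    (hT : T = 1 + X * T ^ 3) (hS : S * (3 - 2 * T) = T) (hu : 3 - 2 * T ≠ 0) :
    derivative ℤ (4 * (X * derivative ℤ S) - 2 * S) =
      27 * derivative ℤ (X * (X * derivative ℤ S)) + 6 * S := by
  set D := derivative ℤ
  have DX : D X = 1 := derivative_X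
  have D_const (n : ℕ) [n.AtLeastTwo] : D (OfNat.ofNat n) = 0 :=
    D.map_natCast n
  have h₁ : D T * (3 - 2 * T) = T ^ 4 := by
    have h := congrArg D hT
    simp only [map_add, Derivation.leibniz, Derivation.leibniz_pow, DX, Derivation.map_one_eq_zero,
      smul_eq_mul, nsmul_eq_mul] at h
    push_cast at h
    linear_combination T * h - 3 * D T * hT
  have h₂ : D S * (3 - 2 * T) ^ 3 = 3 * T ^ 4 := by
    have h := congrArg D hS
    simp only [map_sub, Derivation.leibniz, D_const, smul_eq_mul] at h
    linear_combination (3 - 2 * T) ^ 2 * h + 2 * D T * (3 - 2 * T) * hS + 3 * h₁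
  have h₃ : D (D S) * (3 - 2 * T) ^ 5 = 18 * T ^ 8 + 12 * T ^ 7 * (3 - 2 * T) := by
    have h := congrArg D h₂
    simp only [map_sub, Derivation.leibniz, Derivation.leibniz_pow, D_const, smul_eq_mul,
      nsmul_eq_mul] at h
    push_cast at h
    linear_combination (3 - 2 * T) ^ 2 * h + 6 * (3 - 2 * T) * D T * h₂
      + (18 * T ^ 4 + 12 * T ^ 3 * (3 - 2 * T)) * h₁
  simp only [map_sub, Derivation.leibniz, D_const, DX, smul_eq_mul]
  apply mul_right_cancel₀ (pow_ne_zero 5 hu)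
  have hX : X * T ^ 3 = T - 1 := by linear_combination -hT
  have hX' : X ^ 2 * T ^ 6 = (T - 1) ^ 2 := by linear_combination (X * T ^ 3 + T - 1) * hX
  linear_combination (4 * X - 27 * X ^ 2) * h₃ + (2 - 54 * X) * (3 - 2 * T) ^ 2 * h₂
    - 6 * (3 - 2 * T) ^ 4 * hS
    + (4 * (18 * T ^ 5 + 12 * T ^ 4 * (3 - 2 * T)) - 162 * T * (3 - 2 * T) ^ 2) * hX
    - 27 * (18 * T ^ 2 + 12 * T * (3 - 2 * T)) * hX'

theorem choose_three_mul_succ (n : ℕ) :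
    2 * (n + 1) * (2 * n + 1) * (3 * (n + 1)).choose (n + 1) =
      3 * (3 * n + 1) * (3 * n + 2) * (3 * n).choose n := by
  have h₁ := Nat.add_choose_mul_factorial_mul_factorial (2 * n) n
  have h₂ := Nat.add_choose_mul_factorial_mul_factorial (2 * n + 2) (n + 1)
  rw [show 2 * n + n = 3 * n by ring] at h₁
  rw [show 2 * n + 2 + (n + 1) = 3 * n + 3 by ring] at h₂
  simp only [Nat.factorial_succ] at h₂
  rw [← h₁] at h₂
  rw [show 3 * (n + 1) = 3 * n + 3 by ring]
  apply Nat.eq_of_mul_eq_mul_right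
    (show 0 < (n + 1) * (n.factorial * (2 * n).factorial) by positivity)
  linarith

open PowerSeries in
/-- The differential equation of `∑ (3n choose n) Xⁿ` determines it up to its constant term. -/
theorem eq_mk_choose_three_mul {S : PowerSeries ℤ} (h₀ : coeff 0 S = 1)
    (h : derivative ℤ (4 * (X * derivative ℤ S) - 2 * S) =
      27 * derivative ℤ (X * (X * derivative ℤ S)) + 6 * S) :
    S = mk fun n : ℕ => ((3 * n).choose n : ℤ) := by
  have ofNat_mul (k n : ℕ) [k.AtLeastTwo] (f : PowerSeries ℤ) :
      coeff n (OfNat.ofNat k * f) = OfNat.ofNat k * coeff n f := by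
    simpa using coeff_C_mul n f (OfNat.ofNat k : ℤ)
  have coeff_X_mul_derivative (n : ℕ) : coeff n (X * derivative ℤ S) = n * coeff n S := by
    cases n with
    | zero => simp
    | succ n => rw [coeff_succ_X_mul, coeff_derivative]; push_cast; ring
  ext n
  rw [coeff_mk]
  induction n with
  | zero => simpa using h₀
  | succ n ih =>
    have hn := congrArg (coeff n) h
    simp only [map_add, coeff_derivative, ofNat_mul, coeff_succ_X_mul, coeff_X_mul_derivative,
      map_sub, ih] at hn
    have hc := congrArg (Nat.cast : ℕ → ℤ) (choose_three_mul_succ n)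
    push_cast at hn hc
    apply mul_left_cancel₀ (show (2 * (n + 1) * (2 * n + 1) : ℤ) ≠ 0 by positivity)
    linear_combination hn - hc

theorem central_binomial_series_identity :
    (4 - 27 * PowerSeries.X) *
        (PowerSeries.mk fun n : ℕ => ((3 * n).choose n : ℤ)) ^ 3 =
      1 + 3 * PowerSeries.mk fun n : ℕ => ((3 * n).choose n : ℤ) := by
  obtain ⟨T, hT⟩ := exists_powerSeries_eq_one_add_X_mul_cube
  have hT₀ : PowerSeries.constantCoeff T = 1 := by
    rw [hT]
    simp
  have hu₀ : PowerSeries.constantCoeff (3 - 2 * T) = 1 := by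
    rw [map_sub, map_mul, hT₀, map_ofNat, map_ofNat]
    norm_num
  have hu : IsUnit (3 - 2 * T) := by
    simp [PowerSeries.isUnit_iff_constantCoeff, hu₀]
  obtain ⟨v, hv⟩ := hu.exists_left_inv
  have hS : T * v * (3 - 2 * T) = T := by rw [mul_assoc, hv, mul_one]
  have hS₀ : PowerSeries.coeff 0 (T * v) = 1 := by
    have h := congrArg PowerSeries.constantCoeff hS
    rwa [map_mul _ (T * v), hu₀, hT₀, mul_one,
      ← PowerSeries.coeff_zero_eq_constantCoeff_apply] at h
  rw [← eq_mk_choose_three_mul hS₀ (derivative_eq_of_eq_one_add_X_mul_cube hT hS hu.ne_zero)]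
  apply mul_right_cancel₀ (pow_ne_zero 3 hu.ne_zero)
  generalize T * v = S at hS
  have hS3 : S ^ 3 * (3 - 2 * T) ^ 3 = T ^ 3 := by rw [← mul_pow, hS]
  linear_combination (4 - 27 * PowerSeries.X) * hS3 - 3 * (3 - 2 * T) ^ 2 * hS + 27 * hT
end

section
/- Let a ∈ ℚ[[X]] be the formal power series with constant coefficient 0 and whose coefficient of Xᵐ for m ≥ 1 is binom(3m−2, m−1)/m (these coefficients are the integers 1, 2, 7, 30, … of OEIS sequence A006013). Then the identity a·(1 − a)² = X holds in ℚ[[X]]. -/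
open PowerSeries in
/-- The iterates of `x ↦ X + 2x² - x³` starting at `0`. -/
noncomputable def cubicIter : ℕ → ℚ⟦X⟧
  | 0 => 0
  | n + 1 => X + 2 * cubicIter n ^ 2 - cubicIter n ^ 3

open PowerSeries in
theorem X_dvd_cubicIter (n : ℕ) : (X : ℚ⟦X⟧) ∣ cubicIter n := by
  induction n with
  | zero => exact dvd_zero _
  | succ n ih =>
    obtain ⟨c, hc⟩ := ih
    exact ⟨1 + 2 * X * c ^ 2 - X ^ 2 * c ^ 3, by rw [cubicIter, hc]; ring⟩

open PowerSeries in
theorem X_pow_succ_dvd_cubic_sub {n : ℕ} {x y : ℚ⟦X⟧} (hx : X ∣ x) (hy : X ∣ y)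
    (h : X ^ n ∣ x - y) :
    X ^ (n + 1) ∣ (X + 2 * x ^ 2 - x ^ 3) - (X + 2 * y ^ 2 - y ^ 3) := by
  obtain ⟨c, rfl⟩ := hx
  obtain ⟨d, rfl⟩ := hy
  obtain ⟨e, he⟩ := h
  refine ⟨e * (2 * (c + d) - X * (c ^ 2 + c * d + d ^ 2)), ?_⟩
  linear_combination (2 * (X * c + X * d) - X ^ 2 * (c ^ 2 + c * d + d ^ 2)) * he

open PowerSeries in
theorem X_pow_dvd_cubicIter_succ_sub (n : ℕ) :
    (X : ℚ⟦X⟧) ^ (n + 1) ∣ cubicIter (n + 1) - cubicIter n := by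
  induction n with
  | zero => simp [cubicIter]
  | succ n ih =>
    exact X_pow_succ_dvd_cubic_sub (X_dvd_cubicIter (n + 1)) (X_dvd_cubicIter n) ih

open PowerSeries in
theorem coeff_cubicIter_of_le {k n : ℕ} (h : k ≤ n) :
    coeff k (cubicIter n) = coeff k (cubicIter k) := by
  induction n, h using Nat.le_induction with
  | base => rfl
  | succ n hkn ih =>
    have := X_pow_dvd_iff.1 (X_pow_dvd_cubicIter_succ_sub n) k (by omega)
    rw [map_sub, sub_eq_zero] at this
    rw [this, ih]

open PowerSeries in
theorem exists_mul_one_sub_sq_eq_X :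
    ∃ b : ℚ⟦X⟧, constantCoeff b = 0 ∧ b * (1 - b) ^ 2 = X := by
  let b : ℚ⟦X⟧ := mk fun n => coeff n (cubicIter n)
  have hb (n : ℕ) : X ^ (n + 1) ∣ b - cubicIter n := by
    rw [X_pow_dvd_iff]
    intro m hm
    rw [map_sub, coeff_mk, coeff_cubicIter_of_le (by omega : m ≤ n), sub_self]
  have hXb : X ∣ b := by simpa [cubicIter] using hb 0
  refine ⟨b, X_dvd_iff.1 hXb, ?_⟩
  have key (n : ℕ) : X ^ (n + 2) ∣ b * (1 - b) ^ 2 - X := by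
    have h₁ := X_pow_succ_dvd_cubic_sub hXb (X_dvd_cubicIter n) (hb n)
    have h₂ := hb (n + 1)
    rw [cubicIter] at h₂
    convert dvd_sub h₂ h₁ using 1
    ring
  rw [← sub_eq_zero]
  ext n
  simpa using X_pow_dvd_iff.1 (key n) n (by omega)

open PowerSeries in
theorem ode_of_mul_one_sub_sq_eq_X {b : ℚ⟦X⟧}
    (h : b * (1 - b) ^ 2 = X) :
    (4 * X - 27 * X ^ 2) * d⁄dX ℚ (d⁄dX ℚ b) + (2 - 27 * X) * d⁄dX ℚ b + 3 * b = 2 := by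
  set b₁ := d⁄dX ℚ b with hb₁
  set b₂ := d⁄dX ℚ b₁ with hb₂
  have h₁ : b₁ * ((1 - b) * (1 - 3 * b)) = 1 := by
    have := congrArg (d⁄dX ℚ) h
    simp only [Derivation.leibniz, Derivation.leibniz_pow, map_sub, derivative_X, smul_eq_mul,
      Derivation.map_one_eq_zero, ← hb₁, nsmul_eq_mul] at this
    push_cast at this
    linear_combination this
  have h₂ : b₂ * ((1 - b) * (1 - 3 * b)) = b₁ ^ 2 * (4 - 6 * b) := by
    have h' : b₁ * (1 - 4 * b + 3 * b ^ 2) = 1 := by linear_combination h₁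
    have h3 : d⁄dX ℚ (3 : ℚ⟦X⟧) = 0 := by exact_mod_cast (d⁄dX ℚ).map_natCast 3
    have h4 : d⁄dX ℚ (4 : ℚ⟦X⟧) = 0 := by exact_mod_cast (d⁄dX ℚ).map_natCast 4
    have := congrArg (d⁄dX ℚ) h'
    simp only [Derivation.leibniz, Derivation.leibniz_pow, map_sub, map_add, smul_eq_mul,
      Derivation.map_one_eq_zero, ← hb₁, ← hb₂, nsmul_eq_mul, h3, h4] at this
    push_cast at this
    linear_combination this
  have hne : (1 - b) * (1 - 3 * b) ≠ 0 := right_ne_zero_of_mul_eq_one h₁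
  have h₂' : b₂ * ((1 - b) * (1 - 3 * b)) ^ 3 = 4 - 6 * b := by
    linear_combination ((1 - b) * (1 - 3 * b)) ^ 2 * h₂ +
      (4 - 6 * b) * (b₁ * ((1 - b) * (1 - 3 * b)) + 1) * h₁
  apply mul_right_cancel₀ (pow_ne_zero 3 hne)
  rw [← h]
  linear_combination
    (4 * (b * (1 - b) ^ 2) - 27 * (b * (1 - b) ^ 2) ^ 2) * h₂' +
    (2 - 27 * (b * (1 - b) ^ 2)) * ((1 - b) * (1 - 3 * b)) ^ 2 * h₁

open PowerSeries in
theorem coeff_recurrence_of_ode {b : ℚ⟦X⟧}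
    (h : (4 * X - 27 * X ^ 2) * d⁄dX ℚ (d⁄dX ℚ b) + (2 - 27 * X) * d⁄dX ℚ b + 3 * b = 2)
    (m : ℕ) :
    2 * (2 * m + 1) * (m + 1) * coeff (m + 1) b
      = 3 * (9 * (m : ℚ) ^ 2 - 1) * coeff m b + if m = 0 then 2 else 0 := by
  have h' : C (4 : ℚ) * (X * d⁄dX ℚ (d⁄dX ℚ b)) - C (27 : ℚ) * (X * (X * d⁄dX ℚ (d⁄dX ℚ b)))
      + C (2 : ℚ) * d⁄dX ℚ b - C (27 : ℚ) * (X * d⁄dX ℚ b) + C (3 : ℚ) * b = C (2 : ℚ) := by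
    simp only [map_ofNat]
    linear_combination h
  have := congrArg (coeff m) h'
  simp only [map_add, map_sub, coeff_C_mul, coeff_C] at this
  rcases m with _ | _ | m
  · simp [coeff_derivative] at this ⊢
    linear_combination this
  · simp [coeff_derivative, coeff_succ_X_mul] at this ⊢
    linear_combination this
  · simp [coeff_derivative, coeff_succ_X_mul] at this ⊢
    linear_combination this

theorem choose_recurrence (m : ℕ) :
    2 * (2 * m + 3) * (m + 2) * ((3 * m + 4).choose (m + 1) / (m + 2) : ℚ)
      = 3 * (9 * (m + 1 : ℚ) ^ 2 - 1) * ((3 * m + 1).choose m / (m + 1)) := by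
  rw [Nat.cast_choose ℚ (by omega : m + 1 ≤ 3 * m + 4), Nat.cast_choose ℚ (by omega : m ≤ 3 * m + 1),
    show 3 * m + 4 - (m + 1) = 2 * m + 1 + 1 + 1 by omega, show 3 * m + 1 - m = 2 * m + 1 by omega,
    show 3 * m + 4 = 3 * m + 1 + 1 + 1 + 1 by omega]
  have h₁ := Nat.cast_ne_zero (R := ℚ).2 (Nat.factorial_ne_zero m)
  have h₂ := Nat.cast_ne_zero (R := ℚ).2 (Nat.factorial_ne_zero (2 * m + 1))
  simp only [Nat.factorial_succ (3 * m + 1 + 1 + 1), Nat.factorial_succ (3 * m + 1 + 1),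
    Nat.factorial_succ (3 * m + 1), Nat.factorial_succ (2 * m + 1 + 1),
    Nat.factorial_succ (2 * m + 1), Nat.factorial_succ m]
  push_cast
  have h₃ : (2 * m + 1 + 1 + 1 : ℚ) ≠ 0 := by positivity
  have h₄ : (2 * m + 1 + 1 : ℚ) ≠ 0 := by positivity
  have h₅ : (m + 1 : ℚ) ≠ 0 := by positivity
  have h₆ : (m + 2 : ℚ) ≠ 0 := by positivity
  field_simp
  ring

theorem a006013_series_identity :
    (PowerSeries.mk fun m : ℕ =>
        if m = 0 then (0 : ℚ) else ((3 * m - 2).choose (m - 1) : ℚ) / m) *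
      (1 - PowerSeries.mk fun m : ℕ =>
        if m = 0 then (0 : ℚ) else ((3 * m - 2).choose (m - 1) : ℚ) / m) ^ 2 =
    PowerSeries.X := by
  obtain ⟨b, hb₀, hb⟩ := exists_mul_one_sub_sq_eq_X
  have hrec := coeff_recurrence_of_ode (ode_of_mul_one_sub_sq_eq_X hb)
  have hcoeff (m : ℕ) :
      PowerSeries.coeff (m + 1) b = ((3 * m + 1).choose m : ℚ) / (m + 1) := by
    induction m with
    | zero => simpa [hb₀] using hrec 0
    | succ m ih =>
      have h₁ := hrec (m + 1)
      have h₂ := choose_recurrence m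
      rw [ih] at h₁
      have hne : (2 * (2 * m + 3) * (m + 2) : ℚ) ≠ 0 := by positivity
      apply mul_left_cancel₀ hne
      rw [show 3 * (m + 1) + 1 = 3 * m + 4 by ring]
      push_cast at h₁ ⊢
      rw [show (m : ℚ) + 1 + 1 = m + 2 by ring] at h₁ ⊢
      linear_combination h₁ - h₂
  convert hb <;>
  · ext m
    rcases m with _ | m
    · simp [hb₀]
    · rw [PowerSeries.coeff_mk, if_neg m.succ_ne_zero, hcoeff,
        show 3 * (m + 1) - 2 = 3 * m + 1 by omega, Nat.add_sub_cancel]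
      push_cast
      rfl
end

section
/- For every natural number n, the identity (1/3)ₙ · (2/3)ₙ · (27/4)ⁿ = binom(3n,n) · (1/2)ₙ · n! holds in ℚ, where (x)ₙ denotes the rising factorial x(x+1)⋯(x+n−1). Equivalently, the Maclaurin coefficients of the Gauss hypergeometric series F(1/3, 2/3; 1/2; 27z/4) are exactly the integers binom(3n,n). -/
theorem Nat.succ_choose_three_mul (n : ℕ) :
    (3 * (n + 1)).choose (n + 1) * (2 * (2 * n + 1) * (n + 1)) =
      3 * (3 * n + 1) * (3 * n + 2) * (3 * n).choose n := by
  have h₀ := Nat.add_choose_mul_factorial_mul_factorial (2 * n) n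
  have h₁ := Nat.add_choose_mul_factorial_mul_factorial (2 * n + 2) (n + 1)
  rw [show 2 * n + n = 3 * n by ring] at h₀
  rw [show 2 * n + 2 + (n + 1) = 3 * n + 3 by ring] at h₁
  simp only [Nat.factorial_succ, ← h₀] at h₁
  have hpos : 0 < (2 * n).factorial * n.factorial * (n + 1) := by positivity
  apply Nat.eq_of_mul_eq_mul_right hpos
  rw [show 3 * (n + 1) = 3 * n + 3 by ring]
  linear_combination h₁

theorem hypergeometric_coeff_central_binomial (n : ℕ) :
    (ascPochhammer ℚ n).eval (1 / 3) * (ascPochhammer ℚ n).eval (2 / 3) * (27 / 4) ^ n =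
      ((3 * n).choose n : ℚ) * (ascPochhammer ℚ n).eval (1 / 2) * (n.factorial : ℚ) := by
  induction n with
  | zero => simp
  | succ n ih =>
    have h : ((3 * (n + 1)).choose (n + 1) : ℚ) * (2 * (2 * n + 1) * (n + 1)) =
        3 * (3 * n + 1) * (3 * n + 2) * (3 * n).choose n := by
      exact_mod_cast Nat.succ_choose_three_mul n
    simp only [ascPochhammer_succ_eval, Nat.factorial_succ, pow_succ]
    push_cast
    linear_combination (1 / 3 + n) * (2 / 3 + n) * (27 / 4) * ih -
      (ascPochhammer ℚ n).eval (1 / 2) * (n.factorial : ℚ) / 4 * h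
end

section
/- For every natural number n, the identity (2/3)ₙ · (4/3)ₙ · (27/4)ⁿ = binom(3n+1, n) · (3/2)ₙ · n! holds in ℚ, where (x)ₙ denotes the rising factorial x(x+1)⋯(x+n−1). Equivalently, the Maclaurin coefficients of the Gauss hypergeometric series F(2/3, 4/3; 3/2; 27z/4) are exactly the integers binom(3n+1, n). -/
/-- The first-order recurrence satisfied by the binomial coefficients `(3n+1).choose n`. -/
theorem choose_three_mul_add_one_succ (n : ℕ) :
    ((3 * (n + 1) + 1).choose (n + 1) : ℚ) * ((n + 1) * (2 * n + 2) * (2 * n + 3)) =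
      ((3 * n + 1).choose n : ℚ) * ((3 * n + 2) * (3 * n + 3) * (3 * n + 4)) := by
  rw [Nat.cast_choose ℚ (show n + 1 ≤ 3 * (n + 1) + 1 by lia),
    Nat.cast_choose ℚ (show n ≤ 3 * n + 1 by lia),
    show 3 * (n + 1) + 1 - (n + 1) = 2 * n + 1 + 1 + 1 by lia,
    show 3 * n + 1 - n = 2 * n + 1 by lia,
    show 3 * (n + 1) + 1 = 3 * n + 1 + 1 + 1 + 1 by lia]
  have h₁ : (n.factorial : ℚ) ≠ 0 := by positivity
  have h₂ : ((2 * n + 1).factorial : ℚ) ≠ 0 := by positivity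
  rw [Nat.factorial_succ n, Nat.factorial_succ (2 * n + 1 + 1), Nat.factorial_succ (2 * n + 1),
    Nat.factorial_succ (3 * n + 1 + 1 + 1), Nat.factorial_succ (3 * n + 1 + 1),
    Nat.factorial_succ (3 * n + 1)]
  push_cast
  field_simp
  ring

theorem hypergeometric_coeff_binom_3n1 (n : ℕ) :
    (ascPochhammer ℚ n).eval (2 / 3) * (ascPochhammer ℚ n).eval (4 / 3) * (27 / 4) ^ n =
      ((3 * n + 1).choose n : ℚ) * (ascPochhammer ℚ n).eval (3 / 2) * (n.factorial : ℚ) := by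
  induction n with
  | zero => simp
  | succ n ih =>
    have h := choose_three_mul_add_one_succ n
    have hn : (n + 1 : ℚ) ≠ 0 := by positivity
    simp only [ascPochhammer_succ_eval, Nat.factorial_succ, pow_succ]
    push_cast
    apply mul_right_cancel₀ hn
    linear_combination (2 / 3 + n) * (4 / 3 + n) * (27 / 4) * (n + 1 : ℚ) * ih -
      (ascPochhammer ℚ n).eval (3 / 2) * n.factorial / 4 * h
end

section
/- Let k be a field of characteristic different from 2. In the polynomial ring k[c₁, c₂, c₃] in three variables (Mathlib's MvPolynomial over a three-element index type), the element Δ := c₁²c₂² − 4c₂³ − 4c₁³c₃ + 18c₁c₂c₃ − 27c₃² is a prime element. -/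
/-- The polynomial `4 y³ - y² - 18 t y + 4 t + 27 t²` in `y` has no root in `k[t]`. -/
theorem discriminant_cubic_ne_zero {k : Type*} [Field k] (h4 : (4 : k) ≠ 0) (p : Polynomial k) :
    4 * p ^ 3 - p ^ 2 - 18 * Polynomial.X * p + 4 * Polynomial.X + 27 * Polynomial.X ^ 2 ≠ 0 := by
  intro h
  rcases Nat.eq_zero_or_pos p.natDegree with hd | hd
  · obtain ⟨a, rfl⟩ := Polynomial.natDegree_eq_zero.mp hd
    have h' : Polynomial.C (4 * a ^ 3 - a ^ 2) + Polynomial.C (4 - 18 * a) * Polynomial.X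
        + Polynomial.C 27 * Polynomial.X ^ 2 = 0 := by
      rw [← h]
      simp only [map_sub, map_mul, map_pow, map_ofNat]
      ring
    have e1 := congrArg (Polynomial.coeff · 1) h'
    have e2 := congrArg (Polynomial.coeff · 2) h'
    simp only [Polynomial.coeff_add, Polynomial.coeff_C_mul, Polynomial.coeff_C,
      Polynomial.coeff_X_pow, Polynomial.coeff_X, Polynomial.coeff_zero] at e1 e2
    norm_num at e1 e2
    have h3 : (3 : k) = 0 := by
      have : (3 : k) ^ 3 = 0 := by rw [← e2]; norm_num
      exact pow_eq_zero_iff (by norm_num) |>.mp this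
    exact h4 (by linear_combination e1 + 6 * a * h3)
  · have h' : Polynomial.C 4 * p ^ 3 = p ^ 2 + Polynomial.C 18 * Polynomial.X * p
        - Polynomial.C 4 * Polynomial.X - Polynomial.C 27 * Polynomial.X ^ 2 := by
      simp only [map_ofNat]
      linear_combination h
    have hl : (Polynomial.C 4 * p ^ 3).natDegree = 3 * p.natDegree := by
      rw [Polynomial.natDegree_C_mul h4, Polynomial.natDegree_pow]
    have hr : (p ^ 2 + Polynomial.C 18 * Polynomial.X * p - Polynomial.C 4 * Polynomial.X
        - Polynomial.C 27 * Polynomial.X ^ 2).natDegree ≤ 2 * p.natDegree := by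
      compute_degree
      omega
    rw [← h', hl] at hr
    omega

namespace Polynomial

theorem irreducible_cubic_of_forall_ne_zero {R : Type*} [CommRing R] [IsDomain R] {a b c : R}
    (h : ∀ y, y ^ 3 + a * y ^ 2 + b * y + c ≠ 0) :
    Irreducible (X ^ 3 + C a * X ^ 2 + C b * X + C c) := by
  have hd : (X ^ 3 + C a * X ^ 2 + C b * X + C c).natDegree = 3 := by compute_degree!
  have hm : (X ^ 3 + C a * X ^ 2 + C b * X + C c).Monic := by monicity!
  rw [hm.irreducible_iff_roots_eq_zero_of_degree_le_three (by omega) (by omega)]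
  refine Multiset.eq_zero_of_forall_notMem fun y hy => h y ?_
  simpa using (mem_roots'.mp hy).2

theorem irreducible_cubic_of_map {R S : Type*} [CommRing R] [IsDomain R] [CommRing S]
    (f : R →+* S) {a b c : R} (h : ∀ y, y ^ 3 + f a * y ^ 2 + f b * y + f c ≠ 0) :
    Irreducible (X ^ 3 + C a * X ^ 2 + C b * X + C c) :=
  irreducible_cubic_of_forall_ne_zero fun y hy => h (f y) <| by simpa using congrArg f hy

end Polynomial

open MvPolynomial in
theorem discriminant_prime
    (k : Type*) [Field k] (h2 : (2 : k) ≠ 0) :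
    Prime ((X 0) ^ 2 * (X 1) ^ 2 - 4 * (X 1) ^ 3 - 4 * (X 0) ^ 3 * (X 2)
      + 18 * (X 0) * (X 1) * (X 2) - 27 * (X 2) ^ 2 : MvPolynomial (Fin 3) k) := by
  have h4 : (4 : k) ≠ 0 := by
    simpa [show (2 : k) * 2 = 4 by norm_num] using mul_ne_zero h2 h2
  -- View `Δ` as a cubic polynomial in `c₂` over `k[c₁, c₃]`.
  let e := (renameEquiv k (Equiv.swap (0 : Fin 3) 1)).trans (finSuccEquiv k 2)
  have e0 : e (X 0) = Polynomial.C (X 0) := by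
    simpa [e] using finSuccEquiv_X_succ (R := k) (j := (0 : Fin 2))
  have e1 : e (X 1) = Polynomial.X := by
    simpa [e] using finSuccEquiv_X_zero (R := k) (n := 2)
  have e2 : e (X 2) = Polynomial.C (X 1) := by
    have hs : Equiv.swap (0 : Fin 3) 1 2 = Fin.succ 1 := by decide
    simp only [e, AlgEquiv.trans_apply, renameEquiv_apply, rename_X, hs, finSuccEquiv_X_succ]
  let u : MvPolynomial (Fin 2) k := C 4⁻¹
  have hu : u * 4 = 1 := by
    rw [← map_ofNat (C : k →+* MvPolynomial (Fin 2) k) 4, ← C_mul, inv_mul_cancel₀ h4, C_1]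
  -- Specialize `c₁` to `1`.
  let f : MvPolynomial (Fin 2) k →+* Polynomial k :=
    (aeval ![1, Polynomial.X] : MvPolynomial (Fin 2) k →ₐ[k] Polynomial k).toRingHom
  have hf0 : f (X 0) = 1 := by simp [f]
  have hf1 : f (X 1) = Polynomial.X := by simp [f]
  have hfu : f u * 4 = 1 := by simpa only [map_mul, map_ofNat, map_one] using congrArg f hu
  have hirr := Polynomial.irreducible_cubic_of_map f (a := -u * X 0 ^ 2) (b := -u * 18 * X 0 * X 1)
    (c := X 0 ^ 3 * X 1 + u * 27 * X 1 ^ 2) fun y hy => discriminant_cubic_ne_zero h4 y <| by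
      simp only [map_add, map_mul, map_neg, map_pow, map_ofNat, hf0, hf1] at hy
      linear_combination 4 * hy + (y ^ 2 + 18 * Polynomial.X * y - 27 * Polynomial.X ^ 2) * hfu
  rw [← MulEquiv.prime_iff e]
  have hCu : Polynomial.C u * 4 = 1 := by
    simpa only [map_mul, map_ofNat, map_one] using congrArg Polynomial.C hu
  have hunit : IsUnit (-4 : Polynomial (MvPolynomial (Fin 2) k)) :=
    IsUnit.of_mul_eq_one (-Polynomial.C u) <| by linear_combination hCu
  convert (associated_unit_mul_left _ _ hunit).symm.prime hirr.prime using 1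
  simp only [map_add, map_sub, map_mul, map_neg, map_pow, map_ofNat, e0, e1, e2]
  linear_combination (27 * Polynomial.C (X 1) ^ 2 - Polynomial.C (X 0) ^ 2 * Polynomial.X ^ 2
    - 18 * Polynomial.C (X 0) * Polynomial.C (X 1) * Polynomial.X) * hCu
end

section
/- Let k be a field of characteristic different from 2, let R = k[c₁, c₂, c₃] be the polynomial ring in three variables, and let Δ := c₁²c₂² − 4c₂³ − 4c₁³c₃ + 18c₁c₂c₃ − 27c₃², which generates a prime ideal of R. Let S be the localization of R at the prime ideal (Δ), let A be the adic completion of S with respect to its maximal ideal (the ideal generated by the image of Δ), and let C be the fraction field of A. Writing c₁, c₂, c₃ also for the images of the three variables under the canonical ring homomorphism R → S → A → C, the polynomial t³ + c₁t² + c₂t + c₃ has exactly one root in C: there exists a unique x ∈ C with x³ + c₁·x² + c₂·x + c₃ = 0. -/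
section PrincipalAdic

variable {A : Type*} [CommRing A] {ϖ : A}

/-- In a ring that is Hausdorff for the `ϖ`-adic topology, no nonzero element is divisible by
every power of `ϖ`. -/
theorem IsHausdorff.finiteMultiplicity [IsHausdorff (Ideal.span {ϖ}) A] {a : A} (ha : a ≠ 0) :
    FiniteMultiplicity ϖ a := by
  by_contra h
  rw [FiniteMultiplicity.not_iff_forall] at h
  refine ha (IsHausdorff.haus ‹_› a fun n ↦ ?_)
  rw [SModEq.zero, smul_eq_mul, Ideal.mul_top, Ideal.span_singleton_pow,
    Ideal.mem_span_singleton]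
  exact h n

/-- In an adically complete ring, an element that avoids the maximal ideal of definition
is a unit. -/
theorem IsAdicComplete.isUnit_of_notMem {I : Ideal A} [IsAdicComplete I A] [I.IsMaximal]
    {a : A} (ha : a ∉ I) : IsUnit a := by
  have := isLocalRing_of_isAdicComplete_maximal I
  rw [IsLocalRing.eq_maximalIdeal ‹I.IsMaximal›] at ha
  exact IsLocalRing.notMem_maximalIdeal.mp ha

/-- A ring that is complete for a maximal ideal generated by a regular element is a domain. -/
theorem IsAdicComplete.isDomain_of_span_singleton [IsAdicComplete (Ideal.span {ϖ}) A]
    [(Ideal.span {ϖ}).IsMaximal] (hϖ : ϖ ∈ nonZeroDivisors A) : IsDomain A := by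
  have hunit {a : A} (ha : ¬ ϖ ∣ a) : IsUnit a :=
    IsAdicComplete.isUnit_of_notMem (I := Ideal.span {ϖ}) (by rwa [Ideal.mem_span_singleton])
  have := isLocalRing_of_isAdicComplete_maximal (Ideal.span {ϖ})
  have : NoZeroDivisors A := by
    refine ⟨fun {a b} hab ↦ ?_⟩
    by_contra! h
    obtain ⟨u, hu, hu'⟩ :=
      (IsHausdorff.finiteMultiplicity (ϖ := ϖ) h.1).exists_eq_pow_mul_and_not_dvd
    refine h.2 ?_
    rw [hu, mul_assoc] at hab
    have hub := (mul_left_mem_nonZeroDivisors_eq_zero_iff (pow_mem hϖ _)).mp hab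
    exact (hunit hu').mul_right_eq_zero.mp hub
  exact NoZeroDivisors.to_isDomain A

/-- A prime element is not a square in the fraction field of an adically separated domain. -/
theorem Prime.not_isSquare_algebraMap [IsDomain A] [IsHausdorff (Ideal.span {ϖ}) A]
    (hϖ : Prime ϖ) {K : Type*} [Field K] [Algebra A K] [IsFractionRing A K] :
    ¬ IsSquare (algebraMap A K ϖ) := by
  rintro ⟨z, hz⟩
  obtain ⟨a, b, hb, rfl⟩ := IsFractionRing.div_surjective (A := A) z
  have hb0 : b ≠ 0 := nonZeroDivisors.ne_zero hb
  have hbK : algebraMap A K b ≠ 0 := by simpa using hb0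
  have hab : ϖ * b ^ 2 = a ^ 2 := by
    apply IsFractionRing.injective A K
    rw [map_mul, map_pow, map_pow, hz]
    field_simp
  have ha0 : a ≠ 0 := by
    rintro rfl
    simp [hϖ.ne_zero, hb0] at hab
  have hm := congrArg (multiplicity ϖ) hab
  rw [multiplicity_mul hϖ (IsHausdorff.finiteMultiplicity (mul_ne_zero hϖ.ne_zero
      (pow_ne_zero 2 hb0))),
    (IsHausdorff.finiteMultiplicity hb0).multiplicity_pow hϖ,
    (IsHausdorff.finiteMultiplicity ha0).multiplicity_pow hϖ, multiplicity_self] at hm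
  omega

end PrincipalAdic

section Cubic

variable {A : Type*} [CommRing A] {ϖ c₁ c₂ c₃ : A}

open Polynomial in
/-- A cubic whose discriminant lies in the ideal of definition of a Henselian ring has a simple
root: the reduction of `(-c₁ ^ 3 + 4 * c₁ * c₂ - 9 * c₃) / (c₁ ^ 2 - 3 * c₂)` is a root of the
reduced cubic. -/
theorem HenselianRing.exists_simple_root_cubic {I : Ideal A} [HenselianRing A I]
    (hΔ : c₁ ^ 2 * c₂ ^ 2 - 4 * c₂ ^ 3 - 4 * c₁ ^ 3 * c₃ + 18 * c₁ * c₂ * c₃ - 27 * c₃ ^ 2 ∈ I)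
    (hD : IsUnit (c₁ ^ 2 - 3 * c₂))
    (hE : IsUnit (3 * (-c₁ ^ 3 + 4 * c₁ * c₂ - 9 * c₃) ^ 2
      + 2 * c₁ * (-c₁ ^ 3 + 4 * c₁ * c₂ - 9 * c₃) * (c₁ ^ 2 - 3 * c₂)
      + c₂ * (c₁ ^ 2 - 3 * c₂) ^ 2)) :
    ∃ x : A, x ^ 3 + c₁ * x ^ 2 + c₂ * x + c₃ = 0 ∧ IsUnit (3 * x ^ 2 + 2 * c₁ * x + c₂) := by
  obtain ⟨v, hv⟩ := hD.exists_right_inv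
  set β := (-c₁ ^ 3 + 4 * c₁ * c₂ - 9 * c₃) * v with hβ
  have hderiv : IsUnit (3 * β ^ 2 + 2 * c₁ * β + c₂) := by
    have : 3 * β ^ 2 + 2 * c₁ * β + c₂ = v ^ 2 * (3 * (-c₁ ^ 3 + 4 * c₁ * c₂ - 9 * c₃) ^ 2
      + 2 * c₁ * (-c₁ ^ 3 + 4 * c₁ * c₂ - 9 * c₃) * (c₁ ^ 2 - 3 * c₂)
      + c₂ * (c₁ ^ 2 - 3 * c₂) ^ 2) := by
      rw [hβ]
      generalize c₁ ^ 2 - 3 * c₂ = D at hv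
      generalize -c₁ ^ 3 + 4 * c₁ * c₂ - 9 * c₃ = N
      linear_combination (-2 * c₁ * N * v - c₂ * (D * v + 1)) * hv
    rw [this]
    exact ((IsUnit.of_mul_eq_one_right _ hv).pow 2).mul hE
  have hval : β ^ 3 + c₁ * β ^ 2 + c₂ * β + c₃ ∈ I := by
    have : β ^ 3 + c₁ * β ^ 2 + c₂ * β + c₃ = (v ^ 3 * (2 * c₁ ^ 3 - 9 * c₁ * c₂ + 27 * c₃)) *
        (c₁ ^ 2 * c₂ ^ 2 - 4 * c₂ ^ 3 - 4 * c₁ ^ 3 * c₃ + 18 * c₁ * c₂ * c₃ - 27 * c₃ ^ 2) := by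
      have key : (-c₁ ^ 3 + 4 * c₁ * c₂ - 9 * c₃) ^ 3
          + c₁ * (-c₁ ^ 3 + 4 * c₁ * c₂ - 9 * c₃) ^ 2 * (c₁ ^ 2 - 3 * c₂)
          + c₂ * (-c₁ ^ 3 + 4 * c₁ * c₂ - 9 * c₃) * (c₁ ^ 2 - 3 * c₂) ^ 2
          + c₃ * (c₁ ^ 2 - 3 * c₂) ^ 3 = (2 * c₁ ^ 3 - 9 * c₁ * c₂ + 27 * c₃) *
        (c₁ ^ 2 * c₂ ^ 2 - 4 * c₂ ^ 3 - 4 * c₁ ^ 3 * c₃ + 18 * c₁ * c₂ * c₃ - 27 * c₃ ^ 2) := by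
        ring
      rw [mul_assoc, ← key, hβ]
      generalize c₁ ^ 2 - 3 * c₂ = D at hv
      generalize -c₁ ^ 3 + 4 * c₁ * c₂ - 9 * c₃ = N
      linear_combination (-c₁ * N ^ 2 * v ^ 2 - c₂ * N * v * (D * v + 1)
        - c₃ * (D ^ 2 * v ^ 2 + D * v + 1)) * hv
    rw [this]
    exact I.mul_mem_left _ hΔ
  have hdx (x : A) : (X ^ 3 + C c₁ * X ^ 2 + C c₂ * X + C c₃ : A[X]).derivative.eval x =
      3 * x ^ 2 + 2 * c₁ * x + c₂ := by
    simp
    ring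
  obtain ⟨x, hx, hxβ⟩ := HenselianRing.is_henselian (I := I)
    (X ^ 3 + C c₁ * X ^ 2 + C c₂ * X + C c₃) (by monicity!) β (by simpa using hval)
    (by rw [hdx]; exact hderiv.map _)
  refine ⟨x, by simpa using hx, ?_⟩
  have hmem : (3 * x ^ 2 + 2 * c₁ * x + c₂) - (3 * β ^ 2 + 2 * c₁ * β + c₂) ∈ I := by
    have := I.mul_mem_left (3 * (x + β) + 2 * c₁) hxβ
    convert this using 1
    ring
  obtain ⟨w, hw⟩ := hderiv.exists_right_inv
  have hu : IsUnit ((3 * x ^ 2 + 2 * c₁ * x + c₂) * w) := by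
    have hj := Ideal.mem_jacobson_bot.mp (HenselianRing.jac (I.mul_mem_left w hmem)) 1
    convert hj using 1
    linear_combination hw
  exact isUnit_of_mul_isUnit_left hu

/-- If `ϖ` is a prime of an adically separated domain and a monic cubic of discriminant `ϖ` has a
root in this domain, then it has exactly one root in the fraction field. -/
theorem existsUnique_root_cubic_of_root [IsDomain A] [IsHausdorff (Ideal.span {ϖ}) A]
    (hϖ : Prime ϖ) (K : Type*) [Field K] [Algebra A K] [IsFractionRing A K]
    (hΔ : ϖ = c₁ ^ 2 * c₂ ^ 2 - 4 * c₂ ^ 3 - 4 * c₁ ^ 3 * c₃ + 18 * c₁ * c₂ * c₃ - 27 * c₃ ^ 2)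
    {x : A} (hx : x ^ 3 + c₁ * x ^ 2 + c₂ * x + c₃ = 0) :
    ∃! y : K, y ^ 3 + algebraMap A K c₁ * y ^ 2 + algebraMap A K c₂ * y
      + algebraMap A K c₃ = 0 := by
  have hxK := congrArg (algebraMap A K) hx
  have hΔK := congrArg (algebraMap A K) hΔ
  simp only [map_add, map_sub, map_mul, map_pow, map_zero, map_ofNat] at hxK hΔK
  refine ⟨algebraMap A K x, hxK, fun y hy ↦ ?_⟩
  by_contra hne
  apply hϖ.not_isSquare_algebraMap (K := K)
  generalize algebraMap A K ϖ = d at *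
  generalize algebraMap A K x = x at *
  generalize algebraMap A K c₁ = c₁ at *
  generalize algebraMap A K c₂ = c₂ at *
  generalize algebraMap A K c₃ = c₃ at *
  have hq : y ^ 2 + (c₁ + x) * y + (x ^ 2 + c₁ * x + c₂) = 0 := by
    apply mul_left_cancel₀ (sub_ne_zero.mpr hne)
    linear_combination hy - hxK
  refine ⟨(3 * x ^ 2 + 2 * c₁ * x + c₂) * (2 * y + c₁ + x), ?_⟩
  obtain rfl : c₃ = -(x ^ 3 + c₁ * x ^ 2 + c₂ * x) := by linear_combination hxK
  rw [hΔK]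
  linear_combination (-4 * (3 * x ^ 2 + 2 * c₁ * x + c₂) ^ 2) * hq

end Cubic

/-- Existence and uniqueness of the root over the completion of a Noetherian domain at a maximal
ideal generated by the discriminant. -/
theorem AdicCompletion.existsUnique_root_cubic {S : Type*} [CommRing S] [IsDomain S]
    [IsNoetherianRing S] {π c₁ c₂ c₃ : S} (hπ : π ≠ 0) (hmax : (Ideal.span {π}).IsMaximal)
    (hΔ : π = c₁ ^ 2 * c₂ ^ 2 - 4 * c₂ ^ 3 - 4 * c₁ ^ 3 * c₃ + 18 * c₁ * c₂ * c₃ - 27 * c₃ ^ 2)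
    (hD : IsUnit (c₁ ^ 2 - 3 * c₂))
    (hE : IsUnit (3 * (-c₁ ^ 3 + 4 * c₁ * c₂ - 9 * c₃) ^ 2
      + 2 * c₁ * (-c₁ ^ 3 + 4 * c₁ * c₂ - 9 * c₃) * (c₁ ^ 2 - 3 * c₂)
      + c₂ * (c₁ ^ 2 - 3 * c₂) ^ 2)) :
    letI A := AdicCompletion (Ideal.span {π}) S
    letI f : S →+* FractionRing A := (algebraMap A (FractionRing A)).comp (algebraMap S A)
    ∃! x : FractionRing A, x ^ 3 + f c₁ * x ^ 2 + f c₂ * x + f c₃ = 0 := by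
  let A := AdicCompletion (Ideal.span {π}) S
  have hfg : (Ideal.span {π}).FG := ⟨{π}, by simp⟩
  have hmap : (Ideal.span {π}).map (algebraMap S A) = Ideal.span {algebraMap S A π} := by
    rw [Ideal.map_span, Set.image_singleton]
  have hcomplete : IsAdicComplete (Ideal.span {algebraMap S A π}) A :=
    hmap ▸ AdicCompletion.isAdicComplete_self _ hfg
  have hmaxA : (Ideal.span {algebraMap S A π}).IsMaximal :=
    hmap ▸ AdicCompletion.isMaximal_map_of_le _ _ le_rfl hfg
  have hreg : algebraMap S A π ∈ nonZeroDivisors A := by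
    have hflat : Module.Flat S A := AdicCompletion.flat_of_isNoetherian _
    have hsmul : IsSMulRegular A (algebraMap S A π) :=
      IsSMulRegular.of_flat fun a b hab ↦ mul_left_cancel₀ hπ hab
    rw [mem_nonZeroDivisors_iff_left]
    intro a ha
    exact hsmul (by simpa using ha)
  have hdom : IsDomain A := IsAdicComplete.isDomain_of_span_singleton hreg
  have hprime : Prime (algebraMap S A π) :=
    (Ideal.span_singleton_prime (nonZeroDivisors.ne_zero hreg)).mp hmaxA.isPrime
  have hΔA := congrArg (algebraMap S A) hΔ
  have hDA := hD.map (algebraMap S A)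
  have hEA := hE.map (algebraMap S A)
  simp only [map_add, map_sub, map_mul, map_pow, map_neg, map_ofNat] at hΔA hDA hEA
  obtain ⟨x, hx, -⟩ := HenselianRing.exists_simple_root_cubic
    (I := Ideal.span {algebraMap S A π})
    (hΔA ▸ Ideal.mem_span_singleton_self _) hDA hEA
  exact existsUnique_root_cubic_of_root hprime (FractionRing A) hΔA hx

open MvPolynomial in
/-- Serre's observation: the generic monic cubic has exactly one root in the fraction
field `C` of the completion `A` of the localization of `k[c₁,c₂,c₃]` at the prime ideal
generated by the discriminant. -/
theorem generic_cubic_unique_root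
    (k : Type*) [Field k] (h2 : (2 : k) ≠ 0)
    (Δ : MvPolynomial (Fin 3) k)
    (hΔ : Δ = (X 0) ^ 2 * (X 1) ^ 2 - 4 * (X 1) ^ 3 - 4 * (X 0) ^ 3 * (X 2)
      + 18 * (X 0) * (X 1) * (X 2) - 27 * (X 2) ^ 2)
    (hP : (Ideal.span {Δ}).IsPrime) :
    letI S := Localization (@Ideal.primeCompl _ _ (Ideal.span {Δ}) hP)
    letI A := AdicCompletion
      (Ideal.span {algebraMap (MvPolynomial (Fin 3) k) S Δ}) S
    letI C := FractionRing A
    letI f : MvPolynomial (Fin 3) k →+* C :=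
      (algebraMap A C).comp ((algebraMap S A).comp
        (algebraMap (MvPolynomial (Fin 3) k) S))
    ∃! x : C, x ^ 3 + f (X 0) * x ^ 2 + f (X 1) * x + f (X 2) = 0 := by
  let R := MvPolynomial (Fin 3) k
  let S := Localization.AtPrime (Ideal.span {Δ})
  have hle : (Ideal.span {Δ}).primeCompl ≤ nonZeroDivisors R :=
    Ideal.primeCompl_le_nonZeroDivisors _
  have hdom : IsDomain S := IsLocalization.isDomain_localization hle
  have hnoeth : IsNoetherianRing S :=
    IsLocalization.isNoetherianRing (Ideal.span {Δ}).primeCompl S inferInstance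
  have hΔ0 : Δ ≠ 0 := by
    intro h0
    have h1 := congrArg (eval ![1, 1, 0]) (hΔ.symm.trans h0)
    have h3 := congrArg (eval ![0, 1, 0]) (hΔ.symm.trans h0)
    simp at h1 h3
    have : (1 : k) = 0 := by linear_combination h1 + h3
    exact one_ne_zero this
  have hunit {p : R} (hp : eval (![-1, 0, 0] : Fin 3 → k) p ≠ 0) :
      IsUnit (algebraMap R S p) := by
    refine IsLocalization.map_units S (⟨p, ?_⟩ : (Ideal.span {Δ}).primeCompl)
    intro hmem
    obtain ⟨q, rfl⟩ := Ideal.mem_span_singleton.mp hmem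
    simp [hΔ] at hp
  have hmax : (Ideal.span {algebraMap R S Δ}).IsMaximal := by
    have h := Localization.AtPrime.map_eq_maximalIdeal (I := Ideal.span {Δ})
    rw [Ideal.map_span, Set.image_singleton] at h
    rw [h]
    infer_instance
  have hΔS := congrArg (algebraMap R S) hΔ
  have hD : IsUnit (algebraMap R S (X 0 ^ 2 - 3 * X 1)) := hunit (by simp)
  have hE : IsUnit (algebraMap R S (3 * (-X 0 ^ 3 + 4 * X 0 * X 1 - 9 * X 2) ^ 2
      + 2 * X 0 * (-X 0 ^ 3 + 4 * X 0 * X 1 - 9 * X 2) * (X 0 ^ 2 - 3 * X 1)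
      + X 1 * (X 0 ^ 2 - 3 * X 1) ^ 2)) := hunit (by
    have : (3 : k) + -2 ≠ 0 := by norm_num
    simpa [Odd.neg_pow (by decide : Odd 3)] using this)
  simp only [map_add, map_sub, map_mul, map_pow, map_neg, map_ofNat] at hΔS hD hE
  exact AdicCompletion.existsUnique_root_cubic
    ((map_ne_zero_iff _ (IsLocalization.injective S hle)).mpr hΔ0) hmax hΔS hD hE
end

section
/- Let p, q ∈ ℝ with p < 0 and 27q² < −4p³ (so the discriminant of t³ + pt + q is positive). Set z := −27q²/(4p³) (so 0 ≤ z < 1), θ := arccos((3q/(2p))·√(−3/p)), S₁ := ∑'_{n≥0} ((1/3)ₙ(2/3)ₙ/((3/2)ₙ·n!))·zⁿ, and S₂ := ∑'_{n≥0} ((−1/6)ₙ(1/6)ₙ/((1/2)ₙ·n!))·zⁿ. Then Birkeland's hypergeometric roots coincide with the trigonometric roots of t³ + pt + q as follows: (q/(2p))·S₁ − √(−p)·S₂ = 2√(−p/3)·cos(θ/3 − 4π/3), (q/(2p))·S₁ + √(−p)·S₂ = 2√(−p/3)·cos(θ/3), and −(q/p)·S₁ = 2√(−p/3)·cos(θ/3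 − 2π/3). -/
open Real

/-- A power series with polynomially bounded coefficients converges absolutely on `(-1, 1)`. -/
lemma summable_coeff_mul_pow {c : ℕ → ℝ} {C : ℝ} {k : ℕ} (hc : ∀ n, |c n| ≤ C * (n + k) ^ k)
    {x : ℝ} (hx : |x| < 1) : Summable fun n => c n * x ^ n := by
  obtain ⟨r, hxr, hr⟩ := exists_between hx
  have hr0 : 0 < r := (abs_nonneg x).trans_lt hxr
  have hs : Summable fun n : ℕ => (n : ℝ) ^ k * r ^ n :=
    summable_pow_mul_geometric_of_norm_lt_one k (by rwa [norm_eq_abs, abs_of_pos hr0])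
  refine Summable.of_norm_bounded (((summable_nat_add_iff k).2 hs).mul_left (C / r ^ k)) fun n => ?_
  have : C / r ^ k * (((n + k : ℕ) : ℝ) ^ k * r ^ (n + k)) = C * (n + k) ^ k * r ^ n := by
    push_cast
    field_simp
    ring
  rw [this, norm_mul, norm_pow, norm_eq_abs, norm_eq_abs]
  exact mul_le_mul (hc n) (pow_le_pow_left₀ (abs_nonneg x) hxr.le n) (by positivity)
    ((abs_nonneg _).trans (hc n))

lemma abs_deriv_coeff_le {c : ℕ → ℝ} {C : ℝ} {k : ℕ} (hc : ∀ n, |c n| ≤ C * (n + k) ^ k) (n : ℕ) :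
    |(n + 1) * c (n + 1)| ≤ C * (n + (k + 1 : ℕ)) ^ (k + 1) := by
  have h := hc (n + 1)
  push_cast at h ⊢
  have e : (n : ℝ) + 1 + k = n + (k + 1) := by ring
  rw [e] at h
  rw [abs_mul, abs_of_pos (by positivity : (0 : ℝ) < n + 1)]
  calc ((n : ℝ) + 1) * |c (n + 1)| ≤ (n + (k + 1)) * (C * (n + (k + 1)) ^ k) := by
        gcongr
        linarith [(Nat.cast_nonneg k : (0 : ℝ) ≤ k)]
    _ = _ := by ring

lemma hasDerivAt_tsum_coeff_mul_pow {c : ℕ → ℝ} {C : ℝ} {k : ℕ}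
    (hc : ∀ n, |c n| ≤ C * (n + k) ^ k) {x : ℝ} (hx : |x| < 1) :
    HasDerivAt (fun y => ∑' n, c n * y ^ n) (∑' n : ℕ, (n + 1) * c (n + 1) * x ^ n) x := by
  obtain ⟨r, hxr, hr⟩ := exists_between hx
  have hr0 : 0 < r := (abs_nonneg x).trans_lt hxr
  have hd := summable_coeff_mul_pow (abs_deriv_coeff_le hc) (x := r) (by rwa [abs_of_pos hr0])
  have hu : Summable fun n : ℕ => |c n * (n * r ^ (n - 1))| := by
    rw [← summable_nat_add_iff 1]
    refine hd.abs.congr fun n => ?_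
    push_cast
    congr 1
    ring
  have key := hasDerivAt_tsum_of_isPreconnected (𝕜 := ℝ) (F := ℝ)
    (g := fun n y => c n * y ^ n) (g' := fun n y => c n * (n * y ^ (n - 1)))
    hu (t := Metric.ball 0 r) Metric.isOpen_ball
    (convex_ball (0 : ℝ) r).isPreconnected
    (fun n y _ => (hasDerivAt_pow n y).const_mul (c n))
    (fun n y hy => by
      have hy' : |y| ≤ |r| := by
        rw [abs_of_pos hr0]; simpa using (mem_ball_zero_iff.1 hy).le
      simp only [norm_eq_abs, abs_mul, abs_pow]
      gcongr)
    (Metric.mem_ball_self hr0) (summable_coeff_mul_pow hc (by simp))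
    (y := x) (by simpa using hxr)
  have hs : Summable fun n : ℕ => c n * (n * x ^ (n - 1)) := by
    rw [← summable_nat_add_iff 1]
    refine (summable_coeff_mul_pow (abs_deriv_coeff_le hc) hx).congr fun n => ?_
    push_cast
    ring
  refine key.congr_deriv ?_
  rw [hs.tsum_eq_zero_add]
  simp only [CharP.cast_eq_zero, zero_mul, mul_zero, zero_add]
  refine tsum_congr fun n => ?_
  push_cast
  ring

lemma HasSum.nat_mul_coeff_mul_pow {c : ℕ → ℝ} {x s : ℝ}
    (h : HasSum (fun n : ℕ => (n + 1) * c (n + 1) * x ^ n) s) :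
    HasSum (fun n : ℕ => n * c n * x ^ n) (x * s) := by
  rw [← hasSum_nat_add_iff' 1]
  simp only [Finset.sum_range_one, CharP.cast_eq_zero, zero_mul, sub_zero]
  refine (h.mul_left x).congr_fun ?_
  intro n
  push_cast
  ring

/-- Solutions of `g'' = -ν² g` on `(-π/2, π/2)` are combinations of `cos (ν φ)` and `sin (ν φ)`. -/
lemma eq_cos_add_sin_of_harmonic {ν : ℝ} {g g' : ℝ → ℝ}
    (hg : ∀ φ ∈ Set.Ioo (-(π / 2)) (π / 2), HasDerivAt g (g' φ) φ)
    (hg' : ∀ φ ∈ Set.Ioo (-(π / 2)) (π / 2), HasDerivAt g' (-ν ^ 2 * g φ) φ)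
    {φ : ℝ} (hφ : φ ∈ Set.Ioo (-(π / 2)) (π / 2)) :
    ν * g φ = ν * g 0 * cos (ν * φ) + g' 0 * sin (ν * φ) := by
  have h0 : (0 : ℝ) ∈ Set.Ioo (-(π / 2)) (π / 2) := ⟨by linarith [pi_pos], by linarith [pi_pos]⟩
  have hlin : ∀ t : ℝ, HasDerivAt (fun t => ν * t) ν t := fun t => by
    simpa using (hasDerivAt_id t).const_mul ν
  have const : ∀ f : ℝ → ℝ, (∀ t ∈ Set.Ioo (-(π / 2)) (π / 2), HasDerivAt f 0 t) → f φ = f 0 :=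
    fun f hf => isOpen_Ioo.is_const_of_deriv_eq_zero isPreconnected_Ioo
      (fun t ht => (hf t ht).differentiableAt.differentiableWithinAt)
      (fun t ht => (hf t ht).deriv) hφ h0
  have hA := const (fun t => ν * g t * cos (ν * t) - g' t * sin (ν * t)) fun t ht => by
    refine ((((hg t ht).const_mul ν).mul (hlin t).cos).sub
      ((hg' t ht).mul (hlin t).sin)).congr_deriv ?_
    ring
  have hB := const (fun t => ν * g t * sin (ν * t) + g' t * cos (ν * t)) fun t ht => by
    refine ((((hg t ht).const_mul ν).mul (hlin t).sin).add
      ((hg' t ht).mul (hlin t).cos)).congr_deriv ?_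
    ring
  simp only [mul_zero, cos_zero, sin_zero, mul_one, sub_zero, zero_add] at hA hB
  linear_combination cos (ν * φ) * hA + sin (ν * φ) * hB - ν * g φ * sin_sq_add_cos_sq (ν * φ)

/-- Taylor coefficients of the solution of `(1 - x²) y'' - x y' + ν² y = 0` with
`y 0 = u` and `y' 0 = v`. -/
noncomputable def chebyshevCoeff (ν u v : ℝ) : ℕ → ℝ
  | 0 => u
  | 1 => v
  | n + 2 => (n ^ 2 - ν ^ 2) / ((n + 1) * (n + 2)) * chebyshevCoeff ν u v n

lemma abs_chebyshevCoeff_le {ν : ℝ} (hν : |ν| ≤ 1) (u v : ℝ) (n : ℕ) :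
    |chebyshevCoeff ν u v n| ≤ |u| + |v| := by
  induction n using Nat.twoStepInduction with
  | zero => simp [chebyshevCoeff]
  | one => simp [chebyshevCoeff]
  | more n ih _ =>
    rw [chebyshevCoeff, abs_mul]
    refine (mul_le_of_le_one_left (abs_nonneg _) ?_).trans ih
    have h1 : ν ^ 2 ≤ 1 := (sq_le_one_iff_abs_le_one ν).2 hν
    rw [abs_div, abs_of_pos (by positivity : (0 : ℝ) < (n + 1) * (n + 2)),
      div_le_one (by positivity), abs_le]
    have hn : (0 : ℝ) ≤ n := n.cast_nonneg
    constructor <;> nlinarith [sq_nonneg ν]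

lemma tsum_chebyshevCoeff_sin {ν : ℝ} (hν : |ν| ≤ 1) (u v : ℝ) {φ : ℝ}
    (hφ : φ ∈ Set.Ioo (-(π / 2)) (π / 2)) :
    ν * ∑' n, chebyshevCoeff ν u v n * sin φ ^ n = ν * u * cos (ν * φ) + v * sin (ν * φ) := by
  set c := chebyshevCoeff ν u v with hc_def
  have hc : ∀ n : ℕ, |c n| ≤ (|u| + |v|) * ((n : ℝ) + (0 : ℕ)) ^ 0 := fun n => by
    simpa using abs_chebyshevCoeff_le hν u v n
  have hd := abs_deriv_coeff_le hc
  have he := abs_deriv_coeff_le (c := fun n : ℕ => (n + 1) * c (n + 1)) hd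
  have hsin : ∀ t ∈ Set.Ioo (-(π / 2)) (π / 2), |sin t| < 1 := fun t ht => by
    have := cos_pos_of_mem_Ioo ht
    rw [← sq_lt_one_iff_abs_lt_one]
    nlinarith [sin_sq_add_cos_sq t]
  have key := eq_cos_add_sin_of_harmonic (ν := ν) (g := fun t => ∑' n, c n * sin t ^ n)
    (g' := fun t => (∑' n : ℕ, (n + 1) * c (n + 1) * sin t ^ n) * cos t) (fun t ht =>
      (hasDerivAt_tsum_coeff_mul_pow hc (hsin t ht)).comp t (hasDerivAt_sin t)) (fun t ht => by
      have hx := hsin t ht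
      have h1 := (hasDerivAt_tsum_coeff_mul_pow hd hx).comp t (hasDerivAt_sin t)
      refine (h1.mul (hasDerivAt_cos t)).congr_deriv ?_
      have s0 := (summable_coeff_mul_pow hc hx).hasSum
      have s1 := (summable_coeff_mul_pow hd hx).hasSum
      have s2 := (summable_coeff_mul_pow he hx).hasSum
      have t1 := s1.nat_mul_coeff_mul_pow
      have t2 := s2.nat_mul_coeff_mul_pow (c := fun n : ℕ => (n + 1) * c (n + 1))
      have t3 : HasSum (fun n : ℕ => n * ((n - 1) * c n) * sin t ^ n) _ :=
        HasSum.nat_mul_coeff_mul_pow (c := fun n : ℕ => (n - 1) * c n)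
          (t2.congr_fun fun n => by push_cast; ring)
      have rel := (((s2.sub t3).sub t1).add (s0.mul_left (ν ^ 2))).unique
        (hasSum_zero.congr_fun fun n => by
          have : c (n + 1 + 1) = (n ^ 2 - ν ^ 2) / ((n + 1) * (n + 2)) * c n := rfl
          rw [this]
          push_cast
          field_simp
          ring)
      simp only [Function.comp] at rel ⊢
      push_cast at rel ⊢
      have hcs := sin_sq_add_cos_sq t
      linear_combination rel +
        (∑' n : ℕ, ((n : ℝ) + 1) * ((n + 1 + 1) * c (n + 1 + 1)) * sin t ^ n) * hcs)
    hφ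
  have e0 : ∀ a : ℕ → ℝ, ∑' n, a n * (0 : ℝ) ^ n = a 0 := fun a => by
    rw [tsum_eq_single 0 (by intro n hn; simp [hn])]; simp
  simp only [sin_zero, cos_zero, mul_one] at key
  rw [e0, e0] at key
  simpa [hc_def, chebyshevCoeff] using key

lemma chebyshevCoeff_even (ν u v : ℝ) (n : ℕ) :
    chebyshevCoeff ν u v (2 * n) = u * ((ascPochhammer ℝ n).eval (-ν / 2) *
      (ascPochhammer ℝ n).eval (ν / 2) /
        ((ascPochhammer ℝ n).eval (1 / 2) * (n.factorial : ℝ))) := by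
  induction n with
  | zero => simp [chebyshevCoeff]
  | succ n ih =>
    have h1 := (ascPochhammer_pos n (1 / 2 : ℝ) (by norm_num)).ne'
    have h2 : (1 / 2 + n : ℝ) ≠ 0 := by positivity
    rw [mul_add, mul_one, chebyshevCoeff, ih]
    simp only [ascPochhammer_succ_eval, Nat.factorial_succ]
    push_cast
    field_simp
    ring

lemma chebyshevCoeff_odd (ν u v : ℝ) (n : ℕ) :
    chebyshevCoeff ν u v (2 * n + 1) = v * ((ascPochhammer ℝ n).eval ((1 - ν) / 2) *
      (ascPochhammer ℝ n).eval ((1 + ν) / 2) /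
        ((ascPochhammer ℝ n).eval (3 / 2) * (n.factorial : ℝ))) := by
  induction n with
  | zero => simp [chebyshevCoeff]
  | succ n ih =>
    have h1 := (ascPochhammer_pos n (3 / 2 : ℝ) (by norm_num)).ne'
    have h2 : (3 / 2 + n : ℝ) ≠ 0 := by positivity
    have e : 2 * (n + 1) + 1 = (2 * n + 1) + 2 := by ring
    rw [e, chebyshevCoeff, ih]
    simp only [ascPochhammer_succ_eval, Nat.factorial_succ]
    push_cast
    field_simp
    ring

/-- `₂F₁(-ν/2, ν/2; 1/2; sin² φ) = cos (ν φ)`. -/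
lemma tsum_hypergeometric_eq_cos {ν : ℝ} (hν : |ν| ≤ 1) (hν0 : ν ≠ 0) {φ : ℝ}
    (hφ : φ ∈ Set.Ioo (-(π / 2)) (π / 2)) :
    ∑' n : ℕ, ((ascPochhammer ℝ n).eval (-ν / 2) * (ascPochhammer ℝ n).eval (ν / 2) /
        ((ascPochhammer ℝ n).eval (1 / 2) * (n.factorial : ℝ))) * (sin φ ^ 2) ^ n =
      cos (ν * φ) := by
  have h := tsum_chebyshevCoeff_sin hν 1 0 hφ
  simp only [mul_one, zero_mul, add_zero] at h
  rw [← mul_left_cancel₀ hν0 h]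
  have hinj : Function.Injective fun n : ℕ => 2 * n := fun a b hab => by simpa using hab
  rw [← hinj.tsum_eq (f := fun n => chebyshevCoeff ν 1 0 n * sin φ ^ n)]
  · refine tsum_congr fun n => ?_
    rw [chebyshevCoeff_even]
    ring
  · intro n hn
    rcases Nat.even_or_odd' n with ⟨m, rfl | rfl⟩
    · exact ⟨m, rfl⟩
    · simp [chebyshevCoeff_odd] at hn

/-- `ν sin φ · ₂F₁((1 - ν)/2, (1 + ν)/2; 3/2; sin² φ) = sin (ν φ)`. -/
lemma tsum_hypergeometric_eq_sin {ν : ℝ} (hν : |ν| ≤ 1) {φ : ℝ}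
    (hφ : φ ∈ Set.Ioo (-(π / 2)) (π / 2)) :
    ν * sin φ * ∑' n : ℕ, ((ascPochhammer ℝ n).eval ((1 - ν) / 2) *
      (ascPochhammer ℝ n).eval ((1 + ν) / 2) /
        ((ascPochhammer ℝ n).eval (3 / 2) * (n.factorial : ℝ))) * (sin φ ^ 2) ^ n =
      sin (ν * φ) := by
  have h := tsum_chebyshevCoeff_sin hν 0 1 hφ
  rw [← tsum_mul_left] at h ⊢
  simp only [mul_zero, zero_mul, zero_add, one_mul] at h
  rw [← h]
  have hinj : Function.Injective fun n : ℕ => 2 * n + 1 := fun a b hab => by simpa using hab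
  rw [← hinj.tsum_eq (f := fun n => ν * (chebyshevCoeff ν 0 1 n * sin φ ^ n))]
  · refine tsum_congr fun n => ?_
    rw [chebyshevCoeff_odd]
    ring
  · intro n hn
    rcases Nat.even_or_odd' n with ⟨m, rfl | rfl⟩
    · simp [chebyshevCoeff_even] at hn
    · exact ⟨m, rfl⟩


theorem birkeland_eq_trigonometric
    (p q : ℝ) (hp : p < 0) (h : 27 * q ^ 2 < -4 * p ^ 3)
    (z : ℝ) (hz : z = -27 * q ^ 2 / (4 * p ^ 3))
    (θ : ℝ) (hθ : θ = Real.arccos ((3 * q / (2 * p)) * Real.sqrt (-3 / p)))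
    (S₁ : ℝ) (hS₁ : S₁ = ∑' n : ℕ,
      ((ascPochhammer ℝ n).eval (1 / 3) * (ascPochhammer ℝ n).eval (2 / 3) /
        ((ascPochhammer ℝ n).eval (3 / 2) * (n.factorial : ℝ))) * z ^ n)
    (S₂ : ℝ) (hS₂ : S₂ = ∑' n : ℕ,
      ((ascPochhammer ℝ n).eval (-1 / 6) * (ascPochhammer ℝ n).eval (1 / 6) /
        ((ascPochhammer ℝ n).eval (1 / 2) * (n.factorial : ℝ))) * z ^ n) :
    (q / (2 * p)) * S₁ - Real.sqrt (-p) * S₂ =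
        2 * Real.sqrt (-p / 3) * Real.cos (θ / 3 - 4 * Real.pi / 3) ∧
      (q / (2 * p)) * S₁ + Real.sqrt (-p) * S₂ =
        2 * Real.sqrt (-p / 3) * Real.cos (θ / 3) ∧
      -(q / p) * S₁ = 2 * Real.sqrt (-p / 3) * Real.cos (θ / 3 - 2 * Real.pi / 3) := by
  have hp0 : p ≠ 0 := hp.ne
  have hp3 : p ^ 3 < 0 := Odd.pow_neg (by decide) hp
  set x := (3 * q / (2 * p)) * Real.sqrt (-3 / p) with hx
  have hsq : Real.sqrt (-3 / p) ^ 2 = -3 / p :=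
    Real.sq_sqrt (div_nonneg_of_nonpos (by norm_num) hp.le)
  have hxz : x ^ 2 = z := by
    rw [hx, mul_pow, hsq, hz]
    field_simp
    ring
  have hz1 : z < 1 := by
    rw [hz, div_lt_one_of_neg (by linarith)]
    linarith
  have hx1 : |x| < 1 := by rwa [← sq_lt_one_iff_abs_lt_one, hxz]
  obtain ⟨hxl, hxr⟩ := abs_lt.1 hx1
  have hφ : Real.arcsin x ∈ Set.Ioo (-(π / 2)) (π / 2) :=
    ⟨Real.neg_pi_div_two_lt_arcsin.2 hxl, Real.arcsin_lt_pi_div_two.2 hxr⟩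
  have hsin : Real.sin (Real.arcsin x) = x := Real.sin_arcsin hxl.le hxr.le
  have h13 : |(1 / 3 : ℝ)| ≤ 1 := by norm_num [abs_of_pos]
  have hC := tsum_hypergeometric_eq_cos h13 (by norm_num) hφ
  have hS := tsum_hypergeometric_eq_sin h13 hφ
  rw [hsin, hxz] at hC hS
  norm_num only at hC hS hS₁ hS₂
  rw [← hS₂] at hC
  rw [← hS₁] at hS
  set w := 1 / 3 * Real.arcsin x with hw
  have hθw : θ / 3 = π / 6 - w := by
    rw [hθ, Real.arccos_eq_pi_div_two_sub_arcsin, hw]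
    ring
  have hprod : Real.sqrt (-p / 3) * Real.sqrt (-3 / p) = 1 := by
    rw [← Real.sqrt_mul (by linarith), show -p / 3 * (-3 / p) = 1 by field_simp, Real.sqrt_one]
  have h3 : Real.sqrt (-p / 3) * Real.sqrt 3 = Real.sqrt (-p) := by
    rw [← Real.sqrt_mul (by linarith)]
    congr 1
    ring
  have hqS : q / (2 * p) * S₁ = Real.sqrt (-p / 3) * Real.sin w := by
    rw [← hS, hx]
    linear_combination (-(q / (2 * p) * S₁)) * hprod
  have c1 : Real.cos (θ / 3) = Real.sqrt 3 / 2 * Real.cos w + 1 / 2 * Real.sin w := by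
    rw [hθw, Real.cos_sub, Real.cos_pi_div_six, Real.sin_pi_div_six]
  have c2 : Real.cos (θ / 3 - 2 * π / 3) = -Real.sin w := by
    rw [hθw, show π / 6 - w - 2 * π / 3 = -(w + π / 2) by ring, Real.cos_neg,
      Real.cos_add_pi_div_two]
  have c3 : Real.cos (θ / 3 - 4 * π / 3) =
      1 / 2 * Real.sin w - Real.sqrt 3 / 2 * Real.cos w := by
    rw [hθw, show π / 6 - w - 4 * π / 3 = -((w + π / 6) + π) by ring, Real.cos_neg,
      Real.cos_add_pi, Real.cos_add, Real.cos_pi_div_six, Real.sin_pi_div_six]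
    ring
  rw [c1, c2, c3, hqS, hC, ← h3]
  refine ⟨by ring, by ring, ?_⟩
  have : -(q / p) * S₁ = -2 * (q / (2 * p) * S₁) := by field_simp
  rw [this, hqS]
  ring
end
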